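/- Suppose f is not smoothly conjugate to the linear map m_K(x) = Kx, and let σ > 0 be the square root of the asymptotic variance and χ̄ = ∫ h dμ. Then there exists a constant C > 0 such that for every integer n ≥ 1 and every x ∈ ℝ, |ℙ( √n·(χ_n − χ̄)/σ ≤ x ) − (1/√(2π))·∫_{−∞}^{x} exp(−y²/2) dy| ≤ C·n^{−1/4}. -/

import Mathlib

open MeasureTheory Filter

noncomputable section

/-- The set of periodic points of period `n` (not necessarily least period). -/
def FixPts (f : AddCircle (1:ℝ) → AddCircle (1:ℝ)) (n : ℕ) : Set (AddCircle (1:ℝ)) :=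
  {p | f^[n] p = p}

/-- The transfer operator `ℒφ(x) = ∑_{f y = x} φ y`. -/
def transfer (f : AddCircle (1:ℝ) → AddCircle (1:ℝ)) (φ : AddCircle (1:ℝ) → ℝ) : AddCircle (1:ℝ) → ℝ :=
  fun x => ∑ᶠ y ∈ f ⁻¹' {x}, φ y

/-- The periodic Lyapunov exponent `χ_n(p) = (1/n) ∑_{k<n} log f'(fᵏ p)`. -/
def chi (f : AddCircle (1:ℝ) → AddCircle (1:ℝ)) (f' : AddCircle (1:ℝ) → ℝ) (n : ℕ) (p : AddCircle (1:ℝ)) : ℝ :=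
  (n : ℝ)⁻¹ * ∑ k ∈ Finset.range n, Real.log (f' (f^[k] p))

/-- `f` is smoothly conjugate to the linear map `m_K(x) = Kx`: there is a C¹
diffeomorphism `u` of the circle (given by a C¹ lift `U` with nonvanishing
derivative) with `u ∘ f = m_K ∘ u`. -/
def SmoothConj (K : ℕ) (f : AddCircle (1:ℝ) → AddCircle (1:ℝ)) : Prop :=
  ∃ (u : AddCircle (1:ℝ) → AddCircle (1:ℝ)) (U : ℝ → ℝ), Function.Bijective u ∧ ContDiff ℝ 1 U ∧
    (∀ x : ℝ, deriv U x ≠ 0) ∧ (∀ x : ℝ, u (x : AddCircle (1:ℝ)) = ((U x : ℝ) : AddCircle (1:ℝ))) ∧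
    (∀ p : AddCircle (1:ℝ), u (f p) = K • u p)

/-- The asymptotic variance `σ² = ∫ ĥ² dμ + 2 ∑_{j≥1} ∫ ĥ·(ĥ∘f^j) dμ`,
where `ĥ = log f' - ∫ log f' dμ`. -/
def asymVar (f : AddCircle (1:ℝ) → AddCircle (1:ℝ)) (f' : AddCircle (1:ℝ) → ℝ) (μ : Measure (AddCircle (1:ℝ))) : ℝ :=
  (∫ x, (Real.log (f' x) - ∫ y, Real.log (f' y) ∂μ) ^ 2 ∂μ) +
    2 * ∑' j : ℕ, ∫ x, (Real.log (f' x) - ∫ y, Real.log (f' y) ∂μ) *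
      (Real.log (f' (f^[j + 1] x)) - ∫ y, Real.log (f' y) ∂μ) ∂μ

/-- Gaussian density. -/
def gph (x : ℝ) : ℝ := (Real.sqrt (2 * Real.pi))⁻¹ * Real.exp (-x ^ 2 / 2)

/-- Gaussian distribution function. -/
def gPhi (x : ℝ) : ℝ := (Real.sqrt (2 * Real.pi))⁻¹ * ∫ y in Set.Iic x, Real.exp (-y ^ 2 / 2)

/-- Derivative of the density. -/
def gA (x : ℝ) : ℝ := -x * gph x

lemma gph_pos (x : ℝ) : 0 < gph x := by unfold gph; positivity

lemma gconst_le : (Real.sqrt (2 * Real.pi))⁻¹ ≤ 1 := by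
  apply inv_le_one_of_one_le₀
  rw [Real.one_le_sqrt]
  nlinarith [Real.pi_gt_three]

lemma gph_le_exp (x : ℝ) : gph x ≤ Real.exp (-x ^ 2 / 2) := by
  unfold gph
  have := gconst_le
  have h2 := Real.exp_pos (-x ^ 2 / 2)
  nlinarith

/-- `(1 + x^4) φ(x) ≤ 9`. -/
lemma gph_bound (x : ℝ) : (1 + x ^ 4) * gph x ≤ 9 := by
  have h1 : 1 + x ^ 4 ≤ 9 * Real.exp (x ^ 2 / 2) := by
    have h := Real.quadratic_le_exp_of_nonneg (x := x ^ 2 / 2) (by positivity)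
    have : 0 ≤ x ^ 2 := by positivity
    nlinarith
  have h2 : Real.exp (-x ^ 2 / 2) * Real.exp (x ^ 2 / 2) = 1 := by
    rw [← Real.exp_add]; ring_nf; simp
  have h3 := Real.exp_pos (-x ^ 2 / 2)
  calc (1 + x ^ 4) * gph x ≤ (1 + x ^ 4) * Real.exp (-x ^ 2 / 2) :=
        mul_le_mul_of_nonneg_left (gph_le_exp x) (by positivity)
    _ ≤ 9 * Real.exp (x ^ 2 / 2) * Real.exp (-x ^ 2 / 2) := mul_le_mul_of_nonneg_right h1 h3.le
    _ = 9 := by rw [mul_assoc, mul_comm (Real.exp (x ^ 2 / 2)), h2, mul_one]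

lemma gexp_integrable : Integrable (fun y : ℝ => Real.exp (-y ^ 2 / 2)) := by
  have := integrable_exp_neg_mul_sq (b := 1 / 2) (by norm_num)
  refine this.congr (Eventually.of_forall fun y => ?_)
  simp only; congr 1; ring

lemma gph_integrable : Integrable gph := gexp_integrable.const_mul _

lemma gPhi_hasDerivAt (x : ℝ) : HasDerivAt gPhi (gph x) x := by
  have hc : Continuous (fun y : ℝ => Real.exp (-y ^ 2 / 2)) := by fun_prop
  have h : ∀ z, gPhi z = (Real.sqrt (2 * Real.pi))⁻¹ * ((∫ y in Set.Iic 0, Real.exp (-y ^ 2 / 2)) +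
      ∫ y in (0:ℝ)..z, Real.exp (-y ^ 2 / 2)) := by
    intro z
    unfold gPhi
    rw [← intervalIntegral.integral_Iic_sub_Iic gexp_integrable.integrableOn
      gexp_integrable.integrableOn]
    ring
  have h2 : HasDerivAt (fun z => (Real.sqrt (2 * Real.pi))⁻¹ * ((∫ y in Set.Iic (0:ℝ), Real.exp (-y ^ 2 / 2)) +
      ∫ y in (0:ℝ)..z, Real.exp (-y ^ 2 / 2))) (gph x) x := by
    apply HasDerivAt.const_mul
    apply HasDerivAt.const_add
    exact intervalIntegral.integral_hasDerivAt_right (hc.intervalIntegrable _ _)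
      (hc.stronglyMeasurableAtFilter _ _) hc.continuousAt
  rwa [show gPhi = _ from funext h]

lemma gph_hasDerivAt (x : ℝ) : HasDerivAt gph (gA x) x := by
  have : HasDerivAt (fun x : ℝ => -x ^ 2 / 2) (-x) x := by
    have := ((hasDerivAt_id x).pow 2).neg.div_const 2
    refine this.congr_deriv ?_
    simp
    ring
  have := (this.exp).const_mul (Real.sqrt (2 * Real.pi))⁻¹
  refine this.congr_deriv ?_
  unfold gA gph; ring

/-- Derivative of `gA`. -/
def gB (x : ℝ) : ℝ := (x ^ 2 - 1) * gph x

lemma gA_hasDerivAt (x : ℝ) : HasDerivAt gA (gB x) x := by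
  have := (hasDerivAt_id x).neg.mul (gph_hasDerivAt x)
  refine this.congr_deriv ?_
  unfold gB gA; simp; ring

lemma gA_bound (x : ℝ) : |gA x| ≤ 18 := by
  have h := gph_bound x
  have h0 := gph_pos x
  unfold gA; rw [abs_le]
  constructor <;> nlinarith [mul_nonneg h0.le (sq_nonneg (x-1)), mul_nonneg h0.le (sq_nonneg (x+1)), mul_nonneg h0.le (sq_nonneg (x^2-1))]

lemma gB_bound (x : ℝ) : |gB x| ≤ 18 := by
  have h := gph_bound x
  have h0 := gph_pos x
  unfold gB; rw [abs_le]
  constructor <;> nlinarith [mul_nonneg h0.le (sq_nonneg (x^2-1)), mul_nonneg h0.le (sq_nonneg (x))]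

lemma gzB_bound (x : ℝ) : |x * gB x| ≤ 36 := by
  have h := gph_bound x
  have h0 := gph_pos x
  unfold gB; rw [abs_le]
  constructor <;> nlinarith [mul_nonneg h0.le (sq_nonneg (x^2-1)), mul_nonneg h0.le (sq_nonneg (x-1)), mul_nonneg h0.le (sq_nonneg (x+1)), mul_nonneg h0.le (sq_nonneg (x^2-x)), mul_nonneg h0.le (sq_nonneg (x^2+x))]

lemma gph_le_one (x : ℝ) : |gph x| ≤ 1 := by
  rw [abs_of_pos (gph_pos x)]
  refine (gph_le_exp x).trans ?_
  rw [Real.exp_le_one_iff]; nlinarith [sq_nonneg x]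

/-- mean value bound on the segment from `z` to `z+e` -/
lemma mv_bound (g g' : ℝ → ℝ) (z e M : ℝ)
    (hg : ∀ t, |t| ≤ |e| → HasDerivAt g (g' (z + t)) (z + t))
    (hb : ∀ t, |t| ≤ |e| → |g' (z + t)| ≤ M) : |g (z + e) - g z| ≤ M * |e| := by
  have := Convex.norm_image_sub_le_of_norm_hasDerivWithin_le (f := fun t => g (z + t)) (f' := fun t => g' (z + t))
    (s := Metric.closedBall 0 |e|) (C := M) (x := 0) (y := e) ?_ ?_ (convex_closedBall _ _) (by simp) (by simp)
  · simpa using this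
  · intro t ht
    have ht : |t| ≤ |e| := by simpa using ht
    have := (hg t ht).comp_const_add z t
    exact this.hasDerivWithinAt
  · intro t ht
    exact hb t (by simpa using ht)

lemma gA_lip (z e : ℝ) : |gA (z + e) - gA z| ≤ 18 * |e| :=
  mv_bound gA gB z e 18 (fun _ _ => gA_hasDerivAt _) (fun _ _ => gB_bound _)

lemma gph_taylor (z e : ℝ) : |gph (z + e) - gph z - gA z * e| ≤ 18 * e ^ 2 := by
  have := mv_bound (fun t => gph t - gA z * (t - z)) (fun t => gA t - gA z) z e (18 * |e|)
    (fun t _ => by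
      have := (gph_hasDerivAt (z + t)).sub (((hasDerivAt_id (z + t)).sub_const z).const_mul (gA z))
      exact this.congr_deriv (by simp))
    (fun t ht => (gA_lip z t).trans (by gcongr))
  simp only [add_sub_cancel_left, sub_self, mul_zero, sub_zero] at this
  rw [show gph (z + e) - gph z - gA z * e = gph (z + e) - gA z * e - gph z by ring]
  refine this.trans (le_of_eq ?_)
  rw [mul_assoc, abs_mul_abs_self]; ring

lemma gPhi_taylor (z e : ℝ) :
    |gPhi (z + e) - gPhi z - gph z * e - 1 / 2 * gA z * e ^ 2| ≤ 18 * |e| ^ 3 := by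
  have := mv_bound (fun t => gPhi t - gph z * (t - z) - 1 / 2 * gA z * (t - z) ^ 2)
    (fun t => gph t - gph z - gA z * (t - z)) z e (18 * |e| ^ 2)
    (fun t _ => by
      have := ((gPhi_hasDerivAt (z + t)).sub (((hasDerivAt_id (z + t)).sub_const z).const_mul (gph z))).sub
        ((((hasDerivAt_id (z + t)).sub_const z).pow 2).const_mul (1 / 2 * gA z))
      refine this.congr_deriv ?_
      simp; ring)
    (fun t ht => by
      have := gph_taylor z t
      simp only [add_sub_cancel_left]
      refine this.trans ?_
      rw [← sq_abs t]
      gcongr)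
  simp only [add_sub_cancel_left, sub_self, mul_zero, sub_zero] at this
  rw [show gPhi (z + e) - gPhi z - gph z * e - 1 / 2 * gA z * e ^ 2 =
    gPhi (z + e) - gph z * e - 1 / 2 * gA z * e ^ 2 - gPhi z by ring]
  rw [show (0:ℝ) ^ 2 = 0 by norm_num, mul_zero, sub_zero] at this
  refine this.trans (le_of_eq ?_)
  ring

lemma gPhi_lip (z w : ℝ) : |gPhi z - gPhi w| ≤ |z - w| := by
  have := mv_bound gPhi gph w (z - w) 1 (fun t _ => gPhi_hasDerivAt _) (fun t _ => gph_le_one _)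
  simpa using this

/-- Scaled Gaussian distribution function, `t` the variance. -/
def gG (y t : ℝ) : ℝ := gPhi (y / Real.sqrt t)

/-- Its second space derivative. -/
def gU (y t : ℝ) : ℝ := gA (y / Real.sqrt t) / t

lemma gU_bound (y t : ℝ) (ht : 0 < t) : |gU y t| ≤ 18 / t := by
  unfold gU; rw [abs_div, abs_of_pos ht]
  gcongr; exact gA_bound _

lemma gU_lip (y e t : ℝ) (ht : 0 < t) : |gU (y + e) t - gU y t| ≤ 18 * |e| / Real.sqrt t ^ 3 := by
  unfold gU
  have hs : 0 < Real.sqrt t := Real.sqrt_pos.2 ht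
  have h2 : t = Real.sqrt t ^ 2 := (Real.sq_sqrt ht.le).symm
  rw [← sub_div, abs_div, abs_of_pos ht, add_div]
  refine (div_le_div_of_nonneg_right (gA_lip _ _) ht.le).trans (le_of_eq ?_)
  rw [abs_div, abs_of_pos hs]
  nth_rw 2 [h2]
  field_simp

lemma gG_taylor (y e t : ℝ) (ht : 0 < t) :
    |gG (y + e) t - gG y t - gph (y / Real.sqrt t) / Real.sqrt t * e - 1 / 2 * gU y t * e ^ 2| ≤
      18 * |e| ^ 3 / Real.sqrt t ^ 3 := by
  have hs : 0 < Real.sqrt t := Real.sqrt_pos.2 ht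
  have h2 : t = Real.sqrt t ^ 2 := (Real.sq_sqrt ht.le).symm
  have := gPhi_taylor (y / Real.sqrt t) (e / Real.sqrt t)
  have e1 : gG (y + e) t - gG y t - gph (y / Real.sqrt t) / Real.sqrt t * e - 1 / 2 * gU y t * e ^ 2
     = gPhi (y / Real.sqrt t + e / Real.sqrt t) - gPhi (y / Real.sqrt t) - gph (y / Real.sqrt t) * (e / Real.sqrt t) -
     1 / 2 * gA (y / Real.sqrt t) * (e / Real.sqrt t) ^ 2 := by
    unfold gG gU
    rw [add_div, div_pow, ← h2]
    ring
  rw [e1]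
  refine this.trans (le_of_eq ?_)
  rw [abs_div, abs_of_pos hs, div_pow]; ring

lemma div_sqrt_hasDerivAt (y t : ℝ) (ht : 0 < t) :
    HasDerivAt (fun t => y / Real.sqrt t) (-(y / Real.sqrt t) / (2 * t)) t := by
  have hs : 0 < Real.sqrt t := Real.sqrt_pos.2 ht
  have h2 : Real.sqrt t ^ 2 = t := (Real.sq_sqrt ht.le)
  have := (Real.hasDerivAt_sqrt ht.ne').inv hs.ne' |>.const_mul y
  refine this.congr_deriv ?_
  rw [h2]; field_simp

lemma gG_hasDerivAt_t (y t : ℝ) (ht : 0 < t) :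
    HasDerivAt (fun t => gG y t) (1 / 2 * gU y t) t := by
  have := (gPhi_hasDerivAt (y / Real.sqrt t)).comp t (div_sqrt_hasDerivAt y t ht)
  refine this.congr_deriv ?_
  unfold gU gA; field_simp

lemma gU_hasDerivAt_t (y t : ℝ) (ht : 0 < t) :
    HasDerivAt (fun t => gU y t)
      ((- (1 / 2) * ((y / Real.sqrt t) * gB (y / Real.sqrt t)) - gA (y / Real.sqrt t)) / t ^ 2) t := by
  have := ((gA_hasDerivAt (y / Real.sqrt t)).comp t (div_sqrt_hasDerivAt y t ht)).div (hasDerivAt_id t) ht.ne'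
  refine this.congr_deriv ?_
  simp; field_simp

lemma gU_lip_t (y t v : ℝ) (ht : 0 < t) (hv : 0 ≤ v) : |gU y (t + v) - gU y t| ≤ 36 * v / t ^ 2 := by
  have := Convex.norm_image_sub_le_of_norm_hasDerivWithin_le (f := fun t => gU y t)
    (f' := fun t => ((- (1 / 2) * ((y / Real.sqrt t) * gB (y / Real.sqrt t)) - gA (y / Real.sqrt t)) / t ^ 2))
    (s := Set.Ici t) (C := 36 / t ^ 2) (x := t) (y := t + v) ?_ ?_ (convex_Ici _) (by simp) (by simp [hv])
  · rw [add_sub_cancel_left, Real.norm_eq_abs, Real.norm_eq_abs, abs_of_nonneg hv] at this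
    refine this.trans (le_of_eq (by ring))
  · intro r hr
    exact (gU_hasDerivAt_t y r (lt_of_lt_of_le ht hr)).hasDerivWithinAt
  · intro r hr
    have hr' : t ≤ r := hr
    rw [Real.norm_eq_abs, abs_div, abs_of_nonneg (sq_nonneg r)]
    have h1 := gzB_bound (y / Real.sqrt r)
    have h2 := gA_bound (y / Real.sqrt r)
    gcongr
    rw [abs_le] at *
    constructor <;> linarith [h1.1, h1.2, h2.1, h2.2]

lemma gG_taylor_t (y t v : ℝ) (ht : 0 < t) (hv : 0 ≤ v) :
    |gG y (t + v) - gG y t - 1 / 2 * v * gU y t| ≤ 18 * v ^ 2 / t ^ 2 := by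
  have := Convex.norm_image_sub_le_of_norm_hasDerivWithin_le (f := fun r => gG y r - 1 / 2 * gU y t * r)
    (f' := fun r => 1 / 2 * gU y r - 1 / 2 * gU y t)
    (s := Set.Icc t (t + v)) (C := 18 * v / t ^ 2) (x := t) (y := t + v) ?_ ?_ (convex_Icc _ _) (by simp [hv]) (by simp [hv])
  · rw [add_sub_cancel_left, Real.norm_eq_abs, Real.norm_eq_abs, abs_of_nonneg hv] at this
    rw [show gG y (t + v) - gG y t - 1 / 2 * v * gU y t = gG y (t + v) - 1 / 2 * gU y t * (t + v) -
      (gG y t - 1 / 2 * gU y t * t) by ring]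
    refine this.trans (le_of_eq (by ring))
  · intro r hr
    have := (gG_hasDerivAt_t y r (lt_of_lt_of_le ht hr.1)).sub ((hasDerivAt_id r).const_mul (1 / 2 * gU y t))
    exact (this.congr_deriv (by simp)).hasDerivWithinAt
  · intro r hr
    have := gU_lip_t y t (r - t) ht (by linarith [hr.1])
    rw [show t + (r - t) = r by ring] at this
    rw [Real.norm_eq_abs, ← mul_sub, abs_mul, abs_of_pos (by norm_num : (0:ℝ) < 1 / 2)]
    have h3 : 36 * (r - t) / t ^ 2 ≤ 36 * v / t ^ 2 := by
      gcongr; linarith [hr.2]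
    have : 18 * v / t ^ 2 = 1 / 2 * (36 * v / t ^ 2) := by ring
    linarith

lemma gG_lip_t (y t v : ℝ) (ht : 0 < t) (hv : 0 ≤ v) : |gG y (t + v) - gG y t| ≤ 9 * v / t := by
  have := Convex.norm_image_sub_le_of_norm_hasDerivWithin_le (f := fun r => gG y r)
    (f' := fun r => 1 / 2 * gU y r)
    (s := Set.Ici t) (C := 9 / t) (x := t) (y := t + v) ?_ ?_ (convex_Ici _) (by simp) (by simp [hv])
  · rw [add_sub_cancel_left, Real.norm_eq_abs, Real.norm_eq_abs, abs_of_nonneg hv] at this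
    refine this.trans (le_of_eq (by ring))
  · intro r hr
    exact (gG_hasDerivAt_t y r (lt_of_lt_of_le ht hr)).hasDerivWithinAt
  · intro r hr
    have hr' : t ≤ r := hr
    have := gU_bound y r (lt_of_lt_of_le ht hr)
    rw [Real.norm_eq_abs, abs_mul, abs_of_pos (by norm_num : (0:ℝ) < 1 / 2)]
    have h3 : 18 / r ≤ 18 / t := by gcongr
    have : 9 / t = 1 / 2 * (18 / t) := by ring
    linarith

/-- One step of the Lindeberg argument. -/
lemma one_step (K : ℕ) (hK : 0 < K) (v M : ℝ) (hv : 0 ≤ v) (hM : 0 ≤ M) (t : ℝ) (ht : 1 ≤ t) (y : ℝ)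
    (d b : ℕ → ℝ) (b0 : ℝ) (hd : ∀ i, |d i| ≤ M) (hb : ∀ i, |b i| ≤ M) (hb0 : |b0| ≤ M)
    (hd0 : ∑ i ∈ Finset.range K, d i = 0)
    (hvar : (K : ℝ)⁻¹ * ∑ i ∈ Finset.range K, (1 / 2 * d i ^ 2 + b i) = 1 / 2 * v + b0) :
    |(K : ℝ)⁻¹ * ∑ i ∈ Finset.range K, (gG (y - d i) t + b i * gU (y - d i) t) -
      (gG y (t + v) + b0 * gU y (t + v))| ≤
      (18 * M ^ 3 + 18 * M ^ 2 + 18 * v ^ 2 + 36 * M * v) / Real.sqrt t ^ 3 := by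
  have ht0 : 0 < t := by linarith
  have hs : 0 < Real.sqrt t := Real.sqrt_pos.2 ht0
  have hs1 : 1 ≤ Real.sqrt t := by rwa [Real.one_le_sqrt]
  have h2 : t = Real.sqrt t ^ 2 := (Real.sq_sqrt ht0.le).symm
  have hKr : (0:ℝ) < K := by exact_mod_cast hK
  set r := Real.sqrt t with hr
  have hi : ∀ i ∈ Finset.range K, |gG (y - d i) t + b i * gU (y - d i) t -
      (gG y t - gph (y / r) / r * d i + (1 / 2 * d i ^ 2 + b i) * gU y t)| ≤
      (18 * M ^ 3 + 18 * M ^ 2) / r ^ 3 := by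
    intro i _
    have h3 := gG_taylor y (-d i) t ht0
    have h4 := gU_lip y (-d i) t ht0
    rw [← hr] at h3 h4
    rw [abs_neg] at h3 h4
    have h5 : 18 * |d i| ^ 3 / r ^ 3 ≤ 18 * M ^ 3 / r ^ 3 := by
      gcongr; exact hd i
    have h6 : |b i * (gU (y + -d i) t - gU y t)| ≤ 18 * M ^ 2 / r ^ 3 := by
      rw [abs_mul]
      calc |b i| * |gU (y + -d i) t - gU y t| ≤ M * (18 * M / r ^ 3) := by
            gcongr
            · exact hb i
            · refine h4.trans ?_
              gcongr; exact hd i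
        _ = _ := by ring
    have e : gG (y - d i) t + b i * gU (y - d i) t -
      (gG y t - gph (y / r) / r * d i + (1 / 2 * d i ^ 2 + b i) * gU y t) =
      (gG (y + -d i) t - gG y t - gph (y / r) / r * -d i - 1 / 2 * gU y t * (-d i) ^ 2) +
      b i * (gU (y + -d i) t - gU y t) := by
      rw [← sub_eq_add_neg]; ring
    rw [e, add_div]
    exact (abs_add_le _ _).trans (add_le_add (h3.trans h5) h6)
  have hmain : |(K : ℝ)⁻¹ * ∑ i ∈ Finset.range K, (gG (y - d i) t + b i * gU (y - d i) t) -
      (gG y t + (1 / 2 * v + b0) * gU y t)| ≤ (18 * M ^ 3 + 18 * M ^ 2) / r ^ 3 := by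
    have e : (K : ℝ)⁻¹ * ∑ i ∈ Finset.range K, (gG (y - d i) t + b i * gU (y - d i) t) -
      (gG y t + (1 / 2 * v + b0) * gU y t) = (K : ℝ)⁻¹ * ∑ i ∈ Finset.range K,
      (gG (y - d i) t + b i * gU (y - d i) t -
      (gG y t - gph (y / r) / r * d i + (1 / 2 * d i ^ 2 + b i) * gU y t)) := by
      rw [Finset.sum_sub_distrib, Finset.sum_add_distrib (g := fun i => (1 / 2 * d i ^ 2 + b i) * gU y t),
        Finset.sum_sub_distrib (g := fun i => gph (y / r) / r * d i),
        ← Finset.mul_sum, hd0, ← Finset.sum_mul, ← hvar]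
      simp only [Finset.sum_const, Finset.card_range, nsmul_eq_mul]
      field_simp
      ring
    rw [e, abs_mul, abs_of_pos (inv_pos.2 hKr)]
    calc (K:ℝ)⁻¹ * _ ≤ (K:ℝ)⁻¹ * (K * ((18 * M ^ 3 + 18 * M ^ 2) / r ^ 3)) := by
          gcongr
          refine (Finset.abs_sum_le_sum_abs _ _).trans ?_
          refine (Finset.sum_le_sum hi).trans (le_of_eq ?_)
          simp
      _ = _ := by field_simp
  have h3 := gG_taylor_t y t v ht0 hv
  have h4 := gU_lip_t y t v ht0 hv
  have h5 : 1 / t ^ 2 ≤ 1 / r ^ 3 := by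
    rw [h2]
    apply one_div_le_one_div_of_le (by positivity)
    calc r ^ 3 ≤ r ^ 4 := pow_le_pow_right₀ hs1 (by norm_num)
      _ = _ := by ring
  have h3' : |gG y (t + v) - gG y t - 1 / 2 * v * gU y t| ≤ 18 * v ^ 2 / r ^ 3 := by
    refine h3.trans ?_
    rw [div_eq_mul_one_div, div_eq_mul_one_div _ (r ^ 3)]
    gcongr
  have h4' : |b0 * (gU y (t + v) - gU y t)| ≤ 36 * M * v / r ^ 3 := by
    rw [abs_mul]
    calc |b0| * |gU y (t + v) - gU y t| ≤ M * (36 * v / r ^ 3) := by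
          gcongr
          refine h4.trans ?_
          rw [div_eq_mul_one_div, div_eq_mul_one_div _ (r ^ 3)]
          gcongr
      _ = _ := by ring
  have e2 : (18 * M ^ 3 + 18 * M ^ 2 + 18 * v ^ 2 + 36 * M * v) / r ^ 3 =
    (18 * M ^ 3 + 18 * M ^ 2) / r ^ 3 + 18 * v ^ 2 / r ^ 3 + 36 * M * v / r ^ 3 := by ring
  rw [e2]
  rw [abs_le] at *
  constructor <;> linarith [hmain.1, hmain.2, h3'.1, h3'.2, h4'.1, h4'.2]

/-- telescoping bound -/
lemma sum_tau (v t : ℝ) (hv : 0 < v) (ht : 1 ≤ t) (n : ℕ) :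
    ∑ k ∈ Finset.range n, 1 / Real.sqrt (t + k * v) ^ 3 ≤
      (2 * (1 + v) ^ 2 / v) * (1 / Real.sqrt t - 1 / Real.sqrt (t + n * v)) := by
  induction n with
  | zero => simp
  | succ n ih =>
    rw [Finset.sum_range_succ]
    have hn : (0:ℝ) ≤ n := Nat.cast_nonneg n
    have hT : 1 ≤ t + n * v := by nlinarith
    have key : 1 / Real.sqrt (t + n * v) ^ 3 ≤ (2 * (1 + v) ^ 2 / v) *
        (1 / Real.sqrt (t + n * v) - 1 / Real.sqrt (t + ((n + 1 : ℕ):ℝ) * v)) := by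
      have e : t + ((n + 1 : ℕ):ℝ) * v = t + n * v + v := by push_cast; ring
      rw [e]
      set T := t + n * v
      have ha : 1 ≤ Real.sqrt T := by rwa [Real.one_le_sqrt]
      have hab : Real.sqrt T ≤ Real.sqrt (T + v) := Real.sqrt_le_sqrt (by linarith)
      have hb : Real.sqrt (T + v) ≤ (1 + v) * Real.sqrt T := by
        rw [Real.sqrt_le_left (by positivity), mul_pow, Real.sq_sqrt (by linarith)]
        have h1 : 0 ≤ v * (T - 1) := mul_nonneg hv.le (by linarith)
        have h2 : 0 ≤ v ^ 2 * T := mul_nonneg (sq_nonneg _) (by linarith)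
        nlinarith
      have h1 : Real.sqrt T ^ 2 = T := Real.sq_sqrt (by linarith)
      have h2 : Real.sqrt (T + v) ^ 2 = T + v := Real.sq_sqrt (by linarith)
      set a := Real.sqrt T
      set b := Real.sqrt (T + v)
      have hb0 : 0 < b := by linarith
      have ha0 : 0 < a := by linarith
      have hbav : (b - a) * (b + a) = v := by nlinarith
      have e2 : 1 / a - 1 / b = v / (a * b * (b + a)) := by
        rw [← hbav]; field_simp
      rw [e2]
      have e3 : 2 * (1 + v) ^ 2 / v * (v / (a * b * (b + a))) = 2 * (1 + v) ^ 2 / (a * b * (b + a)) := by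
        field_simp
      rw [e3, div_le_div_iff₀ (by positivity) (by positivity)]
      have h5 : b * (b + a) ≤ ((1 + v) * a) * (2 * ((1 + v) * a)) := by
        apply mul_le_mul hb _ (by positivity) (by positivity)
        nlinarith
      nlinarith
    have := add_le_add ih key
    refine this.trans (le_of_eq ?_)
    ring

lemma sum_range_mul' (m K : ℕ) (g : ℕ → ℝ) :
    ∑ j ∈ Finset.range (m * K), g j = ∑ i ∈ Finset.range K, ∑ j ∈ Finset.range m, g (i + K * j) := by
  rw [Finset.sum_comm]
  induction m with
  | zero => simp
  | succ m ih =>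
    rw [Nat.succ_mul, Finset.sum_range_add, ih, Finset.sum_range_succ]
    congr 1
    apply Finset.sum_congr rfl
    intro i _
    congr 1
    ring

/-- Birkhoff sum. -/
def bS (F h : ℝ → ℝ) (n : ℕ) (z : ℝ) : ℝ := ∑ k ∈ Finset.range n, h (F^[k] z)

/-- Corrected test function. -/
def gGam (a b : ℝ → ℝ) (t x y : ℝ) : ℝ := gG (y - a x) t + b x * gU (y - a x) t

lemma iterate_bound (K : ℕ) (hK : 0 < K) (F I h a b : ℝ → ℝ) (v M : ℝ) (hv : 0 ≤ v) (hM : 0 ≤ M)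
    (hFI : ∀ x, F (I x) = x)
    (hI : ∀ (x : ℝ) (j : ℕ), I (x + K * j) = I x + j)
    (hper : ∀ (x : ℝ) (j : ℕ), h (x + j) = h x)
    (hd : ∀ (x : ℝ) (i : ℕ), |h (I (x + i)) + a (I (x + i)) - a x| ≤ M)
    (hb : ∀ x, |b x| ≤ M)
    (hd0 : ∀ x, ∑ i ∈ Finset.range K, (h (I (x + i)) + a (I (x + i)) - a x) = 0)
    (hvar : ∀ x, (K : ℝ)⁻¹ * ∑ i ∈ Finset.range K,
      (1 / 2 * (h (I (x + i)) + a (I (x + i)) - a x) ^ 2 + b (I (x + i))) = 1 / 2 * v + b x)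
    (t : ℝ) (ht : 1 ≤ t) (n : ℕ) : ∀ x y : ℝ,
    |((K : ℝ) ^ n)⁻¹ * ∑ j ∈ Finset.range (K ^ n),
        gGam a b t (I^[n] (x + j)) (y - bS F h n (I^[n] (x + j))) - gGam a b (t + n * v) x y| ≤
      (18 * M ^ 3 + 18 * M ^ 2 + 18 * v ^ 2 + 36 * M * v) *
        ∑ k ∈ Finset.range n, 1 / Real.sqrt (t + k * v) ^ 3 := by
  have hKr : (0:ℝ) < K := by exact_mod_cast hK
  set C := 18 * M ^ 3 + 18 * M ^ 2 + 18 * v ^ 2 + 36 * M * v with hC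
  have hFIn : ∀ n x, F^[n] (I^[n] x) = x := fun n x => (Function.LeftInverse.iterate hFI n) x
  induction n with
  | zero => intro x y; simp [bS]
  | succ n ih =>
    intro x y
    set E := C * ∑ k ∈ Finset.range n, 1 / Real.sqrt (t + k * v) ^ 3 with hE
    have e1 : ((K : ℝ) ^ (n + 1))⁻¹ * ∑ j ∈ Finset.range (K ^ (n + 1)),
        gGam a b t (I^[n + 1] (x + j)) (y - bS F h (n + 1) (I^[n + 1] (x + j))) =
        (K : ℝ)⁻¹ * ∑ i ∈ Finset.range K, (((K : ℝ) ^ n)⁻¹ * ∑ j ∈ Finset.range (K ^ n),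
          gGam a b t (I^[n] (I (x + i) + j)) (y - h (I (x + i)) - bS F h n (I^[n] (I (x + i) + j)))) := by
      rw [pow_succ K n, sum_range_mul', ← Finset.mul_sum, ← mul_assoc, ← mul_inv, ← pow_succ']
      congr 1
      apply Finset.sum_congr rfl; intro i _
      apply Finset.sum_congr rfl; intro j _
      have e2 : I^[n + 1] (x + ((i + K * j : ℕ) : ℝ)) = I^[n] (I (x + i) + j) := by
        rw [Function.iterate_succ_apply, ← hI]
        congr 2; push_cast; ring
      rw [e2]
      congr 1
      unfold bS
      rw [Finset.sum_range_succ, hFIn, hper]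
      ring
    have hT : 1 ≤ t + n * v := by
      have : (0:ℝ) ≤ n := Nat.cast_nonneg n
      nlinarith [mul_nonneg this hv]
    have h1 := one_step K hK v M hv hM (t + n * v) hT (y - a x)
      (fun i => h (I (x + i)) + a (I (x + i)) - a x) (fun i => b (I (x + i))) (b x) (hd x)
      (fun i => hb _) (hb x) (hd0 x) (hvar x)
    have h2 : |(K : ℝ)⁻¹ * ∑ i ∈ Finset.range K, (((K : ℝ) ^ n)⁻¹ * ∑ j ∈ Finset.range (K ^ n),
          gGam a b t (I^[n] (I (x + i) + j)) (y - h (I (x + i)) - bS F h n (I^[n] (I (x + i) + j)))) -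
        (K : ℝ)⁻¹ * ∑ i ∈ Finset.range K, gGam a b (t + n * v) (I (x + i)) (y - h (I (x + i)))| ≤ E := by
      rw [← mul_sub, ← Finset.sum_sub_distrib, abs_mul, abs_of_pos (inv_pos.2 hKr)]
      calc (K:ℝ)⁻¹ * _ ≤ (K:ℝ)⁻¹ * (K * E) := by
            gcongr
            refine (Finset.abs_sum_le_sum_abs _ _).trans ?_
            refine (Finset.sum_le_sum (fun (i : ℕ) _ => ih (I (x + i)) (y - h (I (x + i))))).trans (le_of_eq ?_)
            simp
        _ = _ := by field_simp
    have e3 : (K : ℝ)⁻¹ * ∑ i ∈ Finset.range K, gGam a b (t + n * v) (I (x + i)) (y - h (I (x + i))) =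
      (K : ℝ)⁻¹ * ∑ i ∈ Finset.range K, (gG (y - a x - (h (I (x + i)) + a (I (x + i)) - a x)) (t + n * v) +
        b (I (x + i)) * gU (y - a x - (h (I (x + i)) + a (I (x + i)) - a x)) (t + n * v)) := by
      congr 1
      apply Finset.sum_congr rfl; intro i _
      unfold gGam
      rw [show y - h (I (x + i)) - a (I (x + i)) = y - a x - (h (I (x + i)) + a (I (x + i)) - a x) by ring]
    have e4 : gGam a b (t + ((n + 1 : ℕ) : ℝ) * v) x y =
        gG (y - a x) (t + n * v + v) + b x * gU (y - a x) (t + n * v + v) := by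
      unfold gGam
      rw [show t + ((n + 1 : ℕ) : ℝ) * v = t + n * v + v by push_cast; ring]
    rw [e1, e4, Finset.sum_range_succ, mul_add, ← hE, mul_one_div]
    rw [e3] at h2
    rw [abs_le] at *
    constructor <;> linarith [h1.1, h1.2, h2.1, h2.2]

/-- The smoothed bound. -/
lemma smooth_bound (K : ℕ) (hK : 0 < K) (F I h a b : ℝ → ℝ) (v M : ℝ) (hv : 0 < v) (hM : 0 ≤ M)
    (hFI : ∀ x, F (I x) = x)
    (hI : ∀ (x : ℝ) (j : ℕ), I (x + K * j) = I x + j)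
    (hper : ∀ (x : ℝ) (j : ℕ), h (x + j) = h x)
    (hd : ∀ (x : ℝ) (i : ℕ), |h (I (x + i)) + a (I (x + i)) - a x| ≤ M)
    (ha : ∀ x, |a x| ≤ M)
    (hb : ∀ x, |b x| ≤ M)
    (hd0 : ∀ x, ∑ i ∈ Finset.range K, (h (I (x + i)) + a (I (x + i)) - a x) = 0)
    (hvar : ∀ x, (K : ℝ)⁻¹ * ∑ i ∈ Finset.range K,
      (1 / 2 * (h (I (x + i)) + a (I (x + i)) - a x) ^ 2 + b (I (x + i))) = 1 / 2 * v + b x) :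
    ∃ C : ℝ, 0 ≤ C ∧ ∀ t : ℝ, 1 ≤ t → ∀ (n : ℕ) (x y : ℝ),
    |((K : ℝ) ^ n)⁻¹ * ∑ j ∈ Finset.range (K ^ n), gG (y - bS F h n (I^[n] (x + j))) t -
      gG y (t + n * v)| ≤ C / Real.sqrt t := by
  have hKr : (0:ℝ) < K := by exact_mod_cast hK
  set C1 := 18 * M ^ 3 + 18 * M ^ 2 + 18 * v ^ 2 + 36 * M * v with hC1
  have hC10 : 0 ≤ C1 := by positivity
  have hGam : ∀ t, 1 ≤ t → ∀ x y, |gGam a b t x y - gG y t| ≤ (19 * M) / Real.sqrt t := by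
    intro t ht x y
    have ht0 : 0 < t := by linarith
    have hs : 0 < Real.sqrt t := Real.sqrt_pos.2 ht0
    have hs1 : 1 ≤ Real.sqrt t := by rwa [Real.one_le_sqrt]
    have h2 : t = Real.sqrt t ^ 2 := (Real.sq_sqrt ht0.le).symm
    have h1 : |gG (y - a x) t - gG y t| ≤ M / Real.sqrt t := by
      unfold gG
      refine (gPhi_lip _ _).trans ?_
      rw [← sub_div, abs_div, abs_of_pos hs]
      gcongr
      rw [show y - a x - y = - a x by ring, abs_neg]; exact ha x
    have h3 : |b x * gU (y - a x) t| ≤ 18 * M / Real.sqrt t := by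
      rw [abs_mul]
      calc |b x| * |gU (y - a x) t| ≤ M * (18 / Real.sqrt t) := by
            gcongr
            · exact hb x
            · refine (gU_bound _ _ ht0).trans ?_
              gcongr
              nlinarith
        _ = _ := by ring
    have e : 19 * M / Real.sqrt t = M / Real.sqrt t + 18 * M / Real.sqrt t := by ring
    rw [e, show gGam a b t x y - gG y t = (gG (y - a x) t - gG y t) + b x * gU (y - a x) t by
      unfold gGam; ring]
    exact (abs_add_le _ _).trans (add_le_add h1 h3)
  refine ⟨C1 * (2 * (1 + v) ^ 2 / v) + 19 * M + 19 * M, by positivity, ?_⟩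
  intro t ht n x y
  have ht0 : 0 < t := by linarith
  have hs : 0 < Real.sqrt t := Real.sqrt_pos.2 ht0
  have hn : (0:ℝ) ≤ n := Nat.cast_nonneg n
  have hT : t ≤ t + n * v := by nlinarith [mul_nonneg hn hv.le]
  have h1 := iterate_bound K hK F I h a b v M hv.le hM hFI hI hper hd hb hd0 hvar t ht n x y
  have h2 : C1 * ∑ k ∈ Finset.range n, 1 / Real.sqrt (t + k * v) ^ 3 ≤
      C1 * (2 * (1 + v) ^ 2 / v) / Real.sqrt t := by
    calc _ ≤ C1 * ((2 * (1 + v) ^ 2 / v) * (1 / Real.sqrt t)) := by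
          gcongr
          refine (sum_tau v t hv ht n).trans ?_
          gcongr
          have : 0 ≤ 1 / Real.sqrt (t + n * v) := by positivity
          linarith
      _ = _ := by ring
  have h3 : |((K : ℝ) ^ n)⁻¹ * ∑ j ∈ Finset.range (K ^ n), gG (y - bS F h n (I^[n] (x + j))) t -
      ((K : ℝ) ^ n)⁻¹ * ∑ j ∈ Finset.range (K ^ n),
        gGam a b t (I^[n] (x + j)) (y - bS F h n (I^[n] (x + j)))| ≤ 19 * M / Real.sqrt t := by
    rw [← mul_sub, ← Finset.sum_sub_distrib, abs_mul, abs_of_pos (by positivity)]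
    calc ((K : ℝ) ^ n)⁻¹ * _ ≤ ((K : ℝ) ^ n)⁻¹ * ((K : ℝ) ^ n * (19 * M / Real.sqrt t)) := by
          gcongr
          refine (Finset.abs_sum_le_sum_abs _ _).trans ?_
          refine (Finset.sum_le_sum (fun (j : ℕ) _ => (abs_sub_comm _ _).le.trans (hGam t ht (I^[n] (x + j)) _))).trans (le_of_eq ?_)
          simp
      _ = _ := by field_simp
  have h4 := hGam (t + n * v) (ht.trans hT) x y
  have h5 : 19 * M / Real.sqrt (t + n * v) ≤ 19 * M / Real.sqrt t := by
    gcongr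
  rw [add_div, add_div]
  rw [abs_le] at *
  constructor <;> linarith [h1.1, h1.2, h3.1, h3.2, h4.1, h4.2]

section Unsmoothing
open ProbabilityTheory


lemma gPhi_eq (t : ℝ) : gPhi t = (gaussianReal 0 1).real (Set.Iic t) := by
  rw [Measure.real, gaussianReal_apply_eq_integral _ (by norm_num), ENNReal.toReal_ofReal
    (integral_nonneg fun x => gaussianPDFReal_nonneg _ _ _)]
  unfold gPhi gaussianPDFReal
  rw [← integral_const_mul]
  simp

lemma gPhi_mem (t : ℝ) : 0 ≤ gPhi t ∧ gPhi t ≤ 1 := by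
  rw [gPhi_eq]; exact ⟨measureReal_nonneg, measureReal_le_one⟩

lemma gauss_sq_int : Integrable (fun z : ℝ => z ^ 2) (gaussianReal 0 1) := by
  have := (memLp_id_gaussianReal (μ := 0) (v := 1) 2).integrable_sq
  simpa using this

lemma gauss_sq : ∫ z, z ^ 2 ∂(gaussianReal 0 1) = 1 := by
  have h := variance_fun_id_gaussianReal (μ := 0) (v := 1)
  rw [variance_of_integral_eq_zero (by fun_prop) (by simp)] at h
  simpa using h

lemma unsmooth_step (R Ψ : ℝ → ℝ) (c η D δ : ℝ) (hδ : 0 < δ) (hR : Monotone R)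
    (hRb : ∀ u, |R u| ≤ 1) (hΨ : ∀ x y, |Ψ x - Ψ y| ≤ c * |x - y|) (hc : 0 ≤ c)
    (hD : ∀ u, |R u - Ψ u| ≤ D)
    (hη : ∀ u, |∫ z, R (u - δ * z) ∂(gaussianReal 0 1) - Ψ u| ≤ η) (u : ℝ) :
    |R u - Ψ u| ≤ 4 / 3 * (η + 3 * (c * δ)) + D / 3 := by
  have hRi : ∀ w, Integrable (fun z => R (w - δ * z)) (gaussianReal 0 1) := by
    intro w
    refine Integrable.of_bound (C := 1) ?_ (Eventually.of_forall fun z => by simpa using hRb _)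
    exact (hR.measurable.comp (by fun_prop)).aestronglyMeasurable
  have hpi : ∀ A B : ℝ, Integrable (fun z : ℝ => A + B * z ^ 2) (gaussianReal 0 1) := by
    intro A B
    exact (integrable_const A).add (gauss_sq_int.const_mul B)
  have hpv : ∀ A B : ℝ, ∫ z : ℝ, (A + B * z ^ 2) ∂(gaussianReal 0 1) = A + B := by
    intro A B
    rw [integral_add (integrable_const A) (gauss_sq_int.const_mul B), integral_const_mul, gauss_sq]
    simp
  have hD0 : 0 ≤ D := (abs_nonneg _).trans (hD 0)
  have hcδ : 0 ≤ c * δ := by positivity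
  have hru := abs_le.1 (hD u)
  have hzz : ∀ z : ℝ, |z| ≤ (1 + z ^ 2) / 2 := by
    intro z
    rw [← sq_abs z]; nlinarith [sq_nonneg (|z| - 1)]
  rw [abs_le]
  constructor
  · -- lower bound
    set r := Ψ u - R u with hr
    have h1 : ∫ z, R (u - 2 * δ - δ * z) ∂(gaussianReal 0 1) ≤
        ∫ z : ℝ, ((Ψ (u - 2 * δ) - r + 5 / 2 * (c * δ)) + ((r + D) / 4 + 1 / 2 * (c * δ)) * z ^ 2) ∂(gaussianReal 0 1) := by
      apply integral_mono (hRi _) (hpi _ _)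
      intro z
      simp only
      by_cases hz : |z| ≤ 2
      · have h2 : R (u - 2 * δ - δ * z) ≤ R u := hR (by nlinarith [(abs_le.1 hz).1])
        have h3 := (abs_le.1 (hΨ (u - 2 * δ) u)).1
        rw [show u - 2 * δ - u = - (2 * δ) by ring, abs_neg, abs_of_pos (by positivity)] at h3
        have h4 : 0 ≤ (r + D) / 4 * z ^ 2 := mul_nonneg (by linarith [hru.1, hru.2]) (sq_nonneg _)
        have h5 : 0 ≤ (c * δ) * z ^ 2 := mul_nonneg hcδ (sq_nonneg _)
        nlinarith
      · push Not at hz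
        have h2 := (abs_le.1 (hD (u - 2 * δ - δ * z))).2
        have h3 := (abs_le.1 (hΨ (u - 2 * δ - δ * z) (u - 2 * δ))).2
        rw [show u - 2 * δ - δ * z - (u - 2 * δ) = - (δ * z) by ring, abs_neg, abs_mul, abs_of_pos hδ] at h3
        have h4 : 0 ≤ (r + D) / 4 * (z ^ 2 - 4) := mul_nonneg (by linarith [hru.1, hru.2])
          (by rw [← sq_abs]; nlinarith)
        have h5 := mul_le_mul_of_nonneg_left (hzz z) hcδ
        nlinarith
    rw [hpv] at h1
    have h2 := (abs_le.1 (hη (u - 2 * δ))).1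
    linarith
  · set r := R u - Ψ u with hr
    have h1 : ∫ z : ℝ, ((Ψ (u + 2 * δ) + r - 5 / 2 * (c * δ)) + (-(r + D) / 4 - 1 / 2 * (c * δ)) * z ^ 2) ∂(gaussianReal 0 1) ≤
        ∫ z, R (u + 2 * δ - δ * z) ∂(gaussianReal 0 1) := by
      apply integral_mono (hpi _ _) (hRi _)
      intro z
      simp only
      by_cases hz : |z| ≤ 2
      · have h2 : R u ≤ R (u + 2 * δ - δ * z) := hR (by nlinarith [(abs_le.1 hz).2])
        have h3 := (abs_le.1 (hΨ (u + 2 * δ) u)).2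
        rw [show u + 2 * δ - u = 2 * δ by ring, abs_of_pos (by positivity)] at h3
        have h4 : 0 ≤ (r + D) / 4 * z ^ 2 := mul_nonneg (by linarith [hru.1, hru.2]) (sq_nonneg _)
        have h5 : 0 ≤ (c * δ) * z ^ 2 := mul_nonneg hcδ (sq_nonneg _)
        nlinarith
      · push Not at hz
        have h2 := (abs_le.1 (hD (u + 2 * δ - δ * z))).1
        have h3 := (abs_le.1 (hΨ (u + 2 * δ - δ * z) (u + 2 * δ))).1
        rw [show u + 2 * δ - δ * z - (u + 2 * δ) = - (δ * z) by ring, abs_neg, abs_mul, abs_of_pos hδ] at h3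
        have h4 : 0 ≤ (r + D) / 4 * (z ^ 2 - 4) := mul_nonneg (by linarith [hru.1, hru.2])
          (by rw [← sq_abs]; nlinarith)
        have h5 := mul_le_mul_of_nonneg_left (hzz z) hcδ
        nlinarith
    rw [hpv] at h1
    have h2 := (abs_le.1 (hη (u + 2 * δ))).2
    linarith

lemma unsmooth (R Ψ : ℝ → ℝ) (c η δ : ℝ) (hδ : 0 < δ) (hR : Monotone R)
    (hRb : ∀ u, |R u| ≤ 1) (hΨ : ∀ x y, |Ψ x - Ψ y| ≤ c * |x - y|) (hc : 0 ≤ c)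
    (hΨb : ∀ u, |Ψ u| ≤ 1)
    (hη : ∀ u, |∫ z, R (u - δ * z) ∂(gaussianReal 0 1) - Ψ u| ≤ η) (u : ℝ) :
    |R u - Ψ u| ≤ 2 * (η + 3 * (c * δ)) := by
  have hbdd : BddAbove (Set.range fun u => |R u - Ψ u|) := by
    refine ⟨2, ?_⟩
    rintro _ ⟨w, rfl⟩
    refine (abs_sub _ _).trans ?_
    linarith [hRb w, hΨb w]
  set D := ⨆ u, |R u - Ψ u|
  have hD : ∀ u, |R u - Ψ u| ≤ D := fun u => le_ciSup hbdd u
  have h1 : D ≤ 4 / 3 * (η + 3 * (c * δ)) + D / 3 :=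
    ciSup_le (unsmooth_step R Ψ c η D δ hδ hR hRb hΨ hc hD hη)
  linarith [hD u]

/-- empirical distribution function -/
def emp (N : ℕ) (X : ℕ → ℝ) (u : ℝ) : ℝ :=
  (N : ℝ)⁻¹ * ∑ j ∈ Finset.range N, (if X j ≤ u then (1:ℝ) else 0)

lemma emp_unsmooth (N : ℕ) (hN : 0 < N) (X : ℕ → ℝ) (δ s η : ℝ) (hδ : 0 < δ) (hs : 0 < s)
    (hη : ∀ u, |(N : ℝ)⁻¹ * ∑ j ∈ Finset.range N, gPhi ((u - X j) / δ) - gPhi (u / s)| ≤ η) (u : ℝ) :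
    |emp N X u - gPhi (u / s)| ≤ 2 * (η + 3 * (δ / s)) := by
  have hNr : (0:ℝ) < N := by exact_mod_cast hN
  have := unsmooth (emp N X) (fun u => gPhi (u / s)) (1 / s) η δ hδ ?_ ?_ ?_ (by positivity) ?_ ?_ u
  · refine this.trans (le_of_eq (by ring))
  · intro p q hpq
    unfold emp
    gcongr with j hj
    split_ifs <;> first | linarith | norm_num
  · intro w
    unfold emp
    rw [abs_of_nonneg (by positivity)]
    calc _ ≤ (N:ℝ)⁻¹ * ∑ j ∈ Finset.range N, (1:ℝ) := by
          gcongr with j hj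
          split_ifs <;> norm_num
      _ = 1 := by simp; field_simp
  · intro p q
    refine (gPhi_lip _ _).trans (le_of_eq ?_)
    rw [← sub_div, abs_div, abs_of_pos hs]; ring
  · intro w
    have := gPhi_mem (w / s)
    rw [abs_le]; constructor <;> linarith
  · intro w
    have e : ∫ z, emp N X (w - δ * z) ∂(gaussianReal 0 1) =
        (N : ℝ)⁻¹ * ∑ j ∈ Finset.range N, gPhi ((w - X j) / δ) := by
      have e1 : ∀ j, (fun z => if X j ≤ w - δ * z then (1:ℝ) else 0) =
          (Set.Iic ((w - X j) / δ)).indicator (fun _ => (1:ℝ)) := by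
        intro j
        ext z
        rw [Set.indicator_apply]
        congr 1
        rw [Set.mem_Iic, le_div_iff₀ hδ]
        apply propext
        constructor <;> intro h <;> linarith
      unfold emp
      rw [integral_const_mul, integral_finsetSum]
      · congr 1
        apply Finset.sum_congr rfl
        intro j _
        rw [e1, integral_indicator measurableSet_Iic, gPhi_eq]
        simp
      · intro j _
        rw [e1]
        exact (integrable_const (1:ℝ)).indicator measurableSet_Iic
    rw [e]
    exact hη w

end Unsmoothing

/-- The standing data: lift `F`, its inverse `I`. -/
structure Dyn (K : ℕ) (F I : ℝ → ℝ) (lam : ℝ) (f : AddCircle (1:ℝ) → AddCircle (1:ℝ)) : Prop where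
  hK : 2 ≤ K
  hlam : 1 < lam
  hFI : ∀ x, F (I x) = x
  hIF : ∀ x, I (F x) = x
  hcon : ∀ x y, |I x - I y| ≤ lam⁻¹ * |x - y|
  hmono : StrictMono F
  hcont : Continuous F
  hdeg : ∀ x, F (x + 1) = F x + K
  hf : ∀ x : ℝ, f (x : AddCircle (1:ℝ)) = ((F x : ℝ) : AddCircle (1:ℝ))

lemma coe_eq_iff (x y : ℝ) : (x : AddCircle (1:ℝ)) = (y : AddCircle (1:ℝ)) ↔ ∃ m : ℤ, x = y + m := by
  rw [← sub_eq_zero, ← AddCircle.coe_sub, AddCircle.coe_eq_zero_iff]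
  constructor
  · rintro ⟨m, hm⟩; refine ⟨m, ?_⟩; simp at hm; linarith
  · rintro ⟨m, hm⟩; refine ⟨m, ?_⟩; simp; linarith

lemma coe_surj (p : AddCircle (1:ℝ)) : ∃ x : ℝ, 0 ≤ x ∧ x < 1 ∧ (x : AddCircle (1:ℝ)) = p := by
  obtain ⟨z, rfl⟩ := QuotientAddGroup.mk_surjective p
  refine ⟨Int.fract z, Int.fract_nonneg _, Int.fract_lt_one _, ?_⟩
  refine (coe_eq_iff _ _).2 ⟨-⌊z⌋, ?_⟩
  rw [Int.fract]; push_cast; ring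

lemma circ_continuous {Y : Type*} [TopologicalSpace Y] (φ : AddCircle (1:ℝ) → Y)
    (h : Continuous fun x : ℝ => φ (x : AddCircle (1:ℝ))) : Continuous φ := by
  have : Topology.IsQuotientMap (fun x : ℝ => (x : AddCircle (1:ℝ))) := isQuotientMap_quotient_mk'
  exact this.continuous_iff.2 h

namespace Dyn

variable {K : ℕ} {F I : ℝ → ℝ} {lam : ℝ} {f : AddCircle (1:ℝ) → AddCircle (1:ℝ)}

lemma Kpos (D : Dyn K F I lam f) : (0:ℝ) < K := by
  have := D.hK
  exact_mod_cast (by omega : 0 < K)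

lemma F_int (D : Dyn K F I lam f) (x : ℝ) (m : ℤ) : F (x + m) = F x + K * m := by
  induction m using Int.induction_on with
  | zero => simp
  | succ i ih =>
    have := D.hdeg (x + i)
    push_cast at *
    rw [← add_assoc, this, ih]; ring
  | pred i ih =>
    have := D.hdeg (x + (-i - 1))
    push_cast at *
    rw [show x + (-(i:ℝ) - 1) + 1 = x + -i by ring, ih] at this
    linarith

lemma I_int (D : Dyn K F I lam f) (x : ℝ) (m : ℤ) : I (x + K * m) = I x + m := by
  have := D.F_int (I x) m
  rw [D.hFI] at this
  rw [← this, D.hIF]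

lemma I_nat (D : Dyn K F I lam f) (x : ℝ) (m : ℕ) : I (x + K * m) = I x + m := by
  have := D.I_int x m
  simpa using this

lemma f_cont (D : Dyn K F I lam f) : Continuous f := by
  apply circ_continuous
  simp only [D.hf]
  exact (AddCircle.continuous_mk' 1).comp D.hcont

lemma inj (D : Dyn K F I lam f) (x : ℝ) :
    Set.InjOn (fun i : ℕ => ((I (x + i) : ℝ) : AddCircle (1:ℝ))) (Finset.range K : Set ℕ) := by
  intro i hi j hj hij
  obtain ⟨m, hm⟩ := (coe_eq_iff _ _).1 hij
  have h1 := congrArg F hm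
  rw [D.F_int, D.hFI, D.hFI] at h1
  have h2 : (i : ℤ) = j + K * m := by
    have : (i : ℝ) = j + K * m := by linarith
    exact_mod_cast this
  have hi : i < K := by simpa using hi
  have hj : j < K := by simpa using hj
  have h3 : ((i : ℤ) % K) = (j : ℤ) % K := by rw [h2]; simp
  rw [Int.emod_eq_of_lt (by omega) (by omega), Int.emod_eq_of_lt (by omega) (by omega)] at h3
  exact_mod_cast h3

lemma preim (D : Dyn K F I lam f) (x : ℝ) :
    f ⁻¹' {(x : AddCircle (1:ℝ))} =
      (fun i : ℕ => ((I (x + i) : ℝ) : AddCircle (1:ℝ))) '' (Finset.range K : Set ℕ) := by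
  ext p
  obtain ⟨z, -, -, rfl⟩ := coe_surj p
  simp only [Set.mem_preimage, Set.mem_singleton_iff, D.hf, coe_eq_iff, Set.mem_image]
  constructor
  · rintro ⟨m, hm⟩
    have hK := D.hK
    have hK0 : (K : ℤ) ≠ 0 := by omega
    refine ⟨(m % K).toNat, ?_, -(m / K), ?_⟩
    · have := Int.emod_lt_of_pos m (by omega : (0:ℤ) < K)
      simp; omega
    · have h0 := Int.emod_nonneg m hK0
      have h1 : (((m % K).toNat : ℕ) : ℝ) = ((m % K : ℤ) : ℝ) := by
        exact_mod_cast Int.toNat_of_nonneg h0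
      rw [h1]
      have h2 : (m : ℝ) = ((m % K : ℤ) : ℝ) + K * ((m / K : ℤ) : ℝ) := by
        exact_mod_cast (Int.emod_add_mul_ediv m K).symm
      rw [← D.hIF z, hm, h2, ← add_assoc, D.I_int]
      push_cast; ring
  · rintro ⟨i, -, m, hm⟩
    refine ⟨i - K * m, ?_⟩
    have : z = I (x + i) + ((-m : ℤ) : ℝ) := by rw [hm]; push_cast; ring
    rw [this, D.F_int, D.hFI]; push_cast; ring

lemma transfer_eq (D : Dyn K F I lam f) (φ : AddCircle (1:ℝ) → ℝ) (x : ℝ) :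
    transfer f φ (x : AddCircle (1:ℝ)) = ∑ i ∈ Finset.range K, φ ((I (x + i) : ℝ) : AddCircle (1:ℝ)) := by
  unfold transfer
  rw [D.preim x, finsum_mem_image (D.inj x), finsum_mem_coe_finset]

end Dyn

/-- Lipschitz through the lift. -/
def LipC (L : ℝ) (φ : AddCircle (1:ℝ) → ℝ) : Prop := ∀ x y : ℝ, |φ x - φ y| ≤ L * |x - y|

namespace LipC

variable {L L' : ℝ} {φ ψ : AddCircle (1:ℝ) → ℝ}

lemma nonneg (h : LipC L φ) : 0 ≤ L := by
  have := (abs_nonneg _).trans (h 1 0)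
  simpa using this

lemma cont (h : LipC L φ) : Continuous φ := by
  apply circ_continuous
  have : LipschitzWith ⟨L, h.nonneg⟩ (fun x : ℝ => φ (x : AddCircle (1:ℝ))) :=
    LipschitzWith.of_dist_le_mul fun x y => by
      rw [Real.dist_eq, Real.dist_eq]; exact h x y
  exact this.continuous

lemma osc (h : LipC L φ) (p q : AddCircle (1:ℝ)) : |φ p - φ q| ≤ L := by
  obtain ⟨x, hx0, hx1, rfl⟩ := coe_surj p
  obtain ⟨y, hy0, hy1, rfl⟩ := coe_surj q
  refine (h x y).trans ?_
  have : |x - y| ≤ 1 := by rw [abs_le]; constructor <;> linarith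
  nlinarith [h.nonneg]

lemma bdd (h : LipC L φ) : ∃ B, 0 ≤ B ∧ ∀ p, |φ p| ≤ B := by
  refine ⟨|φ 0| + L, add_nonneg (abs_nonneg _) h.nonneg, fun p => ?_⟩
  have := h.osc p 0
  have h2 := abs_add_le (φ p - φ 0) (φ 0)
  rw [sub_add_cancel] at h2
  linarith

lemma integ (h : LipC L φ) (μ : Measure (AddCircle (1:ℝ))) [IsProbabilityMeasure μ] : Integrable φ μ := by
  obtain ⟨B, -, hB⟩ := h.bdd
  exact Integrable.of_bound h.cont.aestronglyMeasurable B (Eventually.of_forall fun p => by simpa using hB p)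

lemma mean_zero (h : LipC L φ) (μ : Measure (AddCircle (1:ℝ))) [IsProbabilityMeasure μ]
    (h0 : ∫ x, φ x ∂μ = 0) (p : AddCircle (1:ℝ)) : |φ p| ≤ L := by
  have e : φ p = ∫ q, (φ p - φ q) ∂μ := by
    rw [integral_sub (integrable_const _) (h.integ μ), h0]; simp
  rw [e]
  have := norm_integral_le_of_norm_le_const (μ := μ) (f := fun q => φ p - φ q) (C := L)
    (Eventually.of_forall fun q => by simpa using h.osc p q)
  simpa using this

lemma sub (h : LipC L φ) (h' : LipC L' ψ) : LipC (L + L') (fun p => φ p - ψ p) := by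
  intro x y
  have h1 := abs_le.1 (h x y)
  have h2 := abs_le.1 (h' x y)
  rw [abs_le]; constructor <;> nlinarith [h1.1, h1.2, h2.1, h2.2]

lemma const (c : ℝ) : LipC 0 (fun _ => c) := by intro x y; simp

lemma const_mul (h : LipC L φ) (c : ℝ) : LipC (|c| * L) (fun p => c * φ p) := by
  intro x y
  rw [← mul_sub, abs_mul, mul_assoc]
  exact mul_le_mul_of_nonneg_left (h x y) (abs_nonneg _)

lemma sq (h : LipC L φ) : ∃ L'', LipC L'' (fun p => φ p ^ 2) := by
  obtain ⟨B, hB0, hB⟩ := h.bdd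
  refine ⟨2 * B * L, fun x y => ?_⟩
  rw [sq_sub_sq, abs_mul, mul_assoc]
  apply mul_le_mul _ (h x y) (abs_nonneg _) (by positivity)
  refine (abs_add_le _ _).trans ?_
  linarith [hB x, hB y]

end LipC

/-- Normalized transfer operator. -/
def Pop (K : ℕ) (f : AddCircle (1:ℝ) → AddCircle (1:ℝ)) (φ : AddCircle (1:ℝ) → ℝ) : AddCircle (1:ℝ) → ℝ :=
  fun p => (K : ℝ)⁻¹ * transfer f φ p

namespace Dyn

variable {K : ℕ} {F I : ℝ → ℝ} {lam : ℝ} {f : AddCircle (1:ℝ) → AddCircle (1:ℝ)}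

lemma Pop_coe (D : Dyn K F I lam f) (φ : AddCircle (1:ℝ) → ℝ) (x : ℝ) :
    Pop K f φ (x : AddCircle (1:ℝ)) =
      (K : ℝ)⁻¹ * ∑ i ∈ Finset.range K, φ ((I (x + i) : ℝ) : AddCircle (1:ℝ)) := by
  unfold Pop; rw [D.transfer_eq]

lemma lipP (D : Dyn K F I lam f) {L : ℝ} {φ : AddCircle (1:ℝ) → ℝ} (h : LipC L φ) :
    LipC (L * lam⁻¹) (Pop K f φ) := by
  intro x y
  have hK := D.Kpos
  have hl := D.hlam
  rw [D.Pop_coe, D.Pop_coe, ← mul_sub, ← Finset.sum_sub_distrib, abs_mul, abs_of_pos (inv_pos.2 hK)]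
  calc (K:ℝ)⁻¹ * _ ≤ (K:ℝ)⁻¹ * (K * (L * lam⁻¹ * |x - y|)) := by
        gcongr
        refine (Finset.abs_sum_le_sum_abs _ _).trans ?_
        refine (Finset.sum_le_sum (g := fun _ => L * lam⁻¹ * |x - y|) fun (i : ℕ) _ => ?_).trans (le_of_eq ?_)
        · refine (h _ _).trans ?_
          rw [mul_assoc]
          apply mul_le_mul_of_nonneg_left _ h.nonneg
          refine (D.hcon _ _).trans (le_of_eq ?_)
          congr 2; ring
        · simp
    _ = _ := by field_simp

lemma lipPn (D : Dyn K F I lam f) {L : ℝ} {φ : AddCircle (1:ℝ) → ℝ} (h : LipC L φ) (n : ℕ) :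
    LipC (L * lam⁻¹ ^ n) ((Pop K f)^[n] φ) := by
  induction n with
  | zero => simpa using h
  | succ n ih =>
    rw [Function.iterate_succ_apply', pow_succ, ← mul_assoc]
    exact D.lipP ih

/-- Pull-out property. -/
lemma Pop_mul (D : Dyn K F I lam f) (α β : AddCircle (1:ℝ) → ℝ) (p : AddCircle (1:ℝ)) :
    Pop K f (fun q => α (f q) * β q) p = α p * Pop K f β p := by
  obtain ⟨x, -, -, rfl⟩ := coe_surj p
  rw [D.Pop_coe, D.Pop_coe, mul_left_comm]
  congr 1
  rw [Finset.mul_sum]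
  apply Finset.sum_congr rfl
  intro i _
  congr 1
  rw [D.hf, D.hFI]
  congr 1
  exact (coe_eq_iff _ _).2 ⟨i, by push_cast; ring⟩

set_option linter.unusedSectionVars false
variable {μ : Measure (AddCircle (1:ℝ))} [IsProbabilityMeasure μ]

lemma int_P (D : Dyn K F I lam f)
    (hμ : ∀ φ : AddCircle (1:ℝ) → ℝ, Continuous φ → ∫ x, transfer f φ x ∂μ = (K : ℝ) * ∫ x, φ x ∂μ)
    {φ : AddCircle (1:ℝ) → ℝ} (hφ : Continuous φ) : ∫ x, Pop K f φ x ∂μ = ∫ x, φ x ∂μ := by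
  unfold Pop
  rw [integral_const_mul, hμ φ hφ]
  have := D.Kpos
  field_simp

lemma int_Pn (D : Dyn K F I lam f)
    (hμ : ∀ φ : AddCircle (1:ℝ) → ℝ, Continuous φ → ∫ x, transfer f φ x ∂μ = (K : ℝ) * ∫ x, φ x ∂μ)
    {L : ℝ} {φ : AddCircle (1:ℝ) → ℝ} (hφ : LipC L φ) (n : ℕ) :
    ∫ x, (Pop K f)^[n] φ x ∂μ = ∫ x, φ x ∂μ := by
  induction n with
  | zero => rfl
  | succ n ih => rw [Function.iterate_succ_apply', D.int_P hμ (D.lipPn hφ n).cont, ih]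

lemma duality (D : Dyn K F I lam f)
    (hμ : ∀ φ : AddCircle (1:ℝ) → ℝ, Continuous φ → ∫ x, transfer f φ x ∂μ = (K : ℝ) * ∫ x, φ x ∂μ)
    {L : ℝ} {β : AddCircle (1:ℝ) → ℝ} (hβ : LipC L β) (n : ℕ) :
    ∀ α : AddCircle (1:ℝ) → ℝ, Continuous α →
    ∫ x, α x * (Pop K f)^[n] β x ∂μ = ∫ x, α (f^[n] x) * β x ∂μ := by
  induction n with
  | zero => intro α _; rfl
  | succ n ih =>
    intro α hα
    have h1 : ∀ x, α x * (Pop K f)^[n + 1] β x = Pop K f (fun q => α (f q) * (Pop K f)^[n] β q) x := by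
      intro x
      rw [D.Pop_mul, Function.iterate_succ_apply']
    simp_rw [h1]
    have hc : Continuous (fun q => α (f q) * (Pop K f)^[n] β q) :=
      (hα.comp D.f_cont).mul (D.lipPn hβ n).cont
    rw [D.int_P hμ hc]
    rw [ih (fun q => α (f q)) (hα.comp D.f_cont)]
    simp_rw [Function.iterate_succ_apply']

lemma poisson (D : Dyn K F I lam f)
    (hμ : ∀ φ : AddCircle (1:ℝ) → ℝ, Continuous φ → ∫ x, transfer f φ x ∂μ = (K : ℝ) * ∫ x, φ x ∂μ)
    {L : ℝ} {φ : AddCircle (1:ℝ) → ℝ} (hφ : LipC L φ) (h0 : ∫ x, φ x ∂μ = 0) :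
    ∃ (w : AddCircle (1:ℝ) → ℝ) (L' : ℝ), LipC L' w ∧ (∀ p, HasSum (fun k => (Pop K f)^[k] φ p) (w p)) ∧
      (∀ p, Pop K f w p = w p - φ p) ∧ (∀ k p, |(Pop K f)^[k] φ p| ≤ L * lam⁻¹ ^ k) ∧
      Summable (fun k : ℕ => L * lam⁻¹ ^ k) := by
  have hl := D.hlam
  have hl0 : 0 ≤ lam⁻¹ := by positivity
  have hl1 : lam⁻¹ < 1 := inv_lt_one_of_one_lt₀ hl
  have hsum : Summable (fun k : ℕ => L * lam⁻¹ ^ k) := (summable_geometric_of_lt_one hl0 hl1).mul_left L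
  have hb : ∀ k p, |(Pop K f)^[k] φ p| ≤ L * lam⁻¹ ^ k := fun k p =>
    (D.lipPn hφ k).mean_zero μ (by rw [D.int_Pn hμ hφ, h0]) p
  have hs : ∀ p, Summable (fun k => (Pop K f)^[k] φ p) := fun p =>
    Summable.of_norm_bounded hsum (fun k => by simpa using hb k p)
  refine ⟨fun p => ∑' k, (Pop K f)^[k] φ p, ∑' k, L * lam⁻¹ ^ k, ?_, fun p => (hs p).hasSum, ?_, hb, hsum⟩
  · intro x y
    rw [← (hs x).tsum_sub (hs y), ← tsum_mul_right]
    have := tsum_of_norm_bounded (f := fun k => (Pop K f)^[k] φ x - (Pop K f)^[k] φ y)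
      (hsum.mul_right |x - y|).hasSum (fun k => by simpa using D.lipPn hφ k x y)
    simpa using this
  · intro p
    obtain ⟨x, -, -, rfl⟩ := coe_surj p
    have h1 := (hs (x : AddCircle (1:ℝ))).tsum_eq_zero_add
    simp only
    rw [h1]
    simp only [Function.iterate_zero, id_eq, add_sub_cancel_left, Function.iterate_succ_apply']
    rw [D.Pop_coe, ← Summable.tsum_finsetSum (fun i _ => hs _), ← tsum_mul_left]
    congr 1
    ext k
    rw [D.Pop_coe]


lemma correctors (D : Dyn K F I lam f)
    (hμ : ∀ φ : AddCircle (1:ℝ) → ℝ, Continuous φ → ∫ x, transfer f φ x ∂μ = (K : ℝ) * ∫ x, φ x ∂μ)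
    {L : ℝ} {h : AddCircle (1:ℝ) → ℝ} (hh : LipC L h) (h0 : ∫ x, h x ∂μ = 0) (v : ℝ)
    (hv : v = ∫ x, h x ^ 2 ∂μ + 2 * ∑' j : ℕ, ∫ x, h x * h (f^[j + 1] x) ∂μ) :
    ∃ (a b : AddCircle (1:ℝ) → ℝ) (L1 L2 : ℝ), LipC L1 a ∧ LipC L2 b ∧
      (∀ x : ℝ, ∑ i ∈ Finset.range K, (h (I (x + i) : ℝ) + a (I (x + i) : ℝ) - a x) = 0) ∧
      (∀ x : ℝ, (K : ℝ)⁻¹ * ∑ i ∈ Finset.range K,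
        (1 / 2 * (h (I (x + i) : ℝ) + a (I (x + i) : ℝ) - a x) ^ 2 + b (I (x + i) : ℝ)) =
          1 / 2 * v + b x) := by
  have hKr := D.Kpos
  obtain ⟨w, Lw, hw, hws, hwP, hwb, hsum⟩ := D.poisson hμ hh h0
  set a : AddCircle (1:ℝ) → ℝ := fun p => w p - h p with ha
  have haL : LipC (Lw + L) a := hw.sub hh
  obtain ⟨Lw2, hw2⟩ := hw.sq
  obtain ⟨La2, ha2⟩ := haL.sq
  obtain ⟨Lh2, hh2⟩ := hh.sq
  -- the second corrector
  set V : AddCircle (1:ℝ) → ℝ := fun p => Pop K f (fun q => w q ^ 2) p - a p ^ 2 with hV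
  have hVL := (D.lipP hw2).sub ha2
  have hVi : ∫ p, V p ∂μ = v := by
    have e1 : ∫ p, V p ∂μ = ∫ p, w p ^ 2 ∂μ - ∫ p, a p ^ 2 ∂μ := by
      rw [hV, integral_sub ((D.lipP hw2).integ μ) (ha2.integ μ), D.int_P hμ hw2.cont]
    have hha : Integrable (fun p => h p * a p) μ := by
      obtain ⟨B, -, hB⟩ := hh.bdd
      exact (haL.integ μ).bdd_mul (c := B) hh.cont.aestronglyMeasurable
        (Eventually.of_forall fun p => by simpa using hB p)
    have e2 : ∫ p, w p ^ 2 ∂μ - ∫ p, a p ^ 2 ∂μ = ∫ p, h p ^ 2 ∂μ + 2 * ∫ p, h p * a p ∂μ := by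
      rw [← integral_sub (hw2.integ μ) (ha2.integ μ), ← integral_const_mul,
        ← integral_add (hh2.integ μ) (hha.const_mul 2)]
      congr 1; ext p; simp only [ha]; ring
    have hkint : ∀ k : ℕ, Integrable (fun p => h p * (Pop K f)^[k + 1] h p) μ := by
      intro k
      obtain ⟨B, -, hB⟩ := hh.bdd
      exact ((D.lipPn hh (k + 1)).integ μ).bdd_mul (c := B) hh.cont.aestronglyMeasurable
        (Eventually.of_forall fun p => by simpa using hB p)
    have hsum' : ∀ p, HasSum (fun k => (Pop K f)^[k + 1] h p) (a p) := by
      intro p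
      have := (hasSum_nat_add_iff' (f := fun k => (Pop K f)^[k] h p) 1).2 (hws p)
      simpa [ha] using this
    have e3 : HasSum (fun k : ℕ => ∫ p, h p * (Pop K f)^[k + 1] h p ∂μ) (∫ p, h p * a p ∂μ) := by
      obtain ⟨B, hB0, hB⟩ := hh.bdd
      have hb : ∀ (k : ℕ) (p : AddCircle (1:ℝ)), ‖h p * (Pop K f)^[k + 1] h p‖ ≤ B * (L * lam⁻¹ ^ (k + 1)) := by
        intro k p
        rw [norm_mul]
        exact mul_le_mul (by simpa using hB p) (by simpa using hwb (k + 1) p) (norm_nonneg _) hB0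
      have := hasSum_integral_of_summable_integral_norm hkint (μ := μ) ?_
      · have e4 : (fun p => ∑' k : ℕ, h p * (Pop K f)^[k + 1] h p) = fun p => h p * a p := by
          ext p
          rw [tsum_mul_left, (hsum' p).tsum_eq]
        rwa [e4] at this
      · refine Summable.of_nonneg_of_le (fun k => integral_nonneg fun p => norm_nonneg _) (fun k => ?_)
          (((summable_nat_add_iff 1).2 hsum).mul_left B)
        have := integral_mono (hkint k).norm (integrable_const (μ := μ) (B * (L * lam⁻¹ ^ (k + 1)))) (hb k)
        simpa using this
    rw [e1, e2, hv, ← e3.tsum_eq]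
    congr 2
    apply tsum_congr
    intro k
    rw [D.duality hμ hh (k + 1) h hh.cont]
    congr 1; ext p; ring
  have hφL : LipC _ (fun p => 1 / 2 * (V p - v)) := (hVL.sub (LipC.const v)).const_mul (1 / 2)
  have hφ0 : ∫ p, 1 / 2 * (V p - v) ∂μ = 0 := by
    rw [integral_const_mul, integral_sub (hVL.integ μ) (integrable_const _), hVi]
    simp
  obtain ⟨b, Lb, hb, -, hbP, -, -⟩ := D.poisson hμ hφL hφ0
  refine ⟨a, b, _, _, haL, hb, ?_, ?_⟩
  · intro x
    have h1 := hwP x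
    rw [D.Pop_coe] at h1
    have h2 : ∑ i ∈ Finset.range K, w ((I (x + i) : ℝ) : AddCircle (1:ℝ)) = K * a x := by
      simp only [ha]; rw [← h1]; field_simp
    have h3 : ∀ i : ℕ, h (I (x + i) : ℝ) + a (I (x + i) : ℝ) - a x = w (I (x + i) : ℝ) - a x := by
      intro i; simp only [ha]; ring
    simp_rw [h3]
    rw [Finset.sum_sub_distrib, h2]; simp
  · intro x
    have h1 := hwP x
    rw [D.Pop_coe] at h1
    have h2 : ∑ i ∈ Finset.range K, w ((I (x + i) : ℝ) : AddCircle (1:ℝ)) = K * a x := by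
      simp only [ha]; rw [← h1]; field_simp
    have h3 : ∀ i : ℕ, 1 / 2 * (h (I (x + i) : ℝ) + a (I (x + i) : ℝ) - a x) ^ 2 + b (I (x + i) : ℝ) =
        1 / 2 * w (I (x + i) : ℝ) ^ 2 - a x * w (I (x + i) : ℝ) + 1 / 2 * a x ^ 2 + b (I (x + i) : ℝ) := by
      intro i; simp only [ha]; ring
    have h4 := hbP x
    have h5 : V x = Pop K f (fun q => w q ^ 2) x - a x ^ 2 := rfl
    rw [D.Pop_coe] at h4
    rw [h5, D.Pop_coe] at h4
    simp_rw [h3]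
    rw [Finset.sum_add_distrib, Finset.sum_add_distrib, Finset.sum_sub_distrib, ← Finset.mul_sum,
      ← Finset.mul_sum, h2]
    simp only [Finset.sum_const, Finset.card_range, nsmul_eq_mul]
    rw [mul_add, h4]
    field_simp
    ring

end Dyn

lemma exists_fix (g : ℝ → ℝ) (q : ℝ) (hq0 : 0 ≤ q) (hq : q < 1) (h : ∀ x y, |g x - g y| ≤ q * |x - y|) :
    ∃ x, g x = x := by
  have hc : ContractingWith ⟨q, hq0⟩ g :=
    ⟨by exact_mod_cast hq, LipschitzWith.of_dist_le_mul fun x y => by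
      rw [Real.dist_eq, Real.dist_eq]; exact h x y⟩
  exact ⟨_, hc.fixedPoint_isFixedPt⟩

namespace Dyn

variable {K : ℕ} {F I : ℝ → ℝ} {lam : ℝ} {f : AddCircle (1:ℝ) → AddCircle (1:ℝ)}

lemma linv (D : Dyn K F I lam f) : 0 ≤ lam⁻¹ ∧ lam⁻¹ < 1 := by
  have hl := D.hlam
  exact ⟨by positivity, inv_lt_one_of_one_lt₀ hl⟩

lemma conN (D : Dyn K F I lam f) (n : ℕ) (x y : ℝ) :
    |I^[n] x - I^[n] y| ≤ lam⁻¹ ^ n * |x - y| := by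
  induction n with
  | zero => simp
  | succ n ih =>
    rw [Function.iterate_succ_apply', Function.iterate_succ_apply']
    refine (D.hcon _ _).trans ?_
    rw [pow_succ', mul_assoc]
    exact mul_le_mul_of_nonneg_left ih D.linv.1

lemma FIn (D : Dyn K F I lam f) (n : ℕ) (x : ℝ) : F^[n] (I^[n] x) = x :=
  (Function.LeftInverse.iterate D.hFI n) x

lemma IFn (D : Dyn K F I lam f) (n : ℕ) (x : ℝ) : I^[n] (F^[n] x) = x :=
  (Function.LeftInverse.iterate D.hIF n) x

lemma Fn_int (D : Dyn K F I lam f) (n : ℕ) (x : ℝ) (m : ℤ) : F^[n] (x + m) = F^[n] x + K ^ n * m := by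
  induction n with
  | zero => simp
  | succ n ih =>
    rw [Function.iterate_succ_apply', Function.iterate_succ_apply', ih]
    have := D.F_int (F^[n] x) (K ^ n * m)
    push_cast at this
    rw [this]; ring

lemma fn (D : Dyn K F I lam f) (n : ℕ) (x : ℝ) :
    f^[n] (x : AddCircle (1:ℝ)) = ((F^[n] x : ℝ) : AddCircle (1:ℝ)) := by
  induction n with
  | zero => rfl
  | succ n ih => rw [Function.iterate_succ_apply', Function.iterate_succ_apply', ih, D.hf]

lemma fixed (D : Dyn K F I lam f) : ∃ c, F c = c := by
  obtain ⟨c, hc⟩ := exists_fix I _ D.linv.1 D.linv.2 D.hcon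
  exact ⟨c, by rw [← hc, D.hFI, hc]⟩

/-- strict expansion of the iterate -/
lemma exp_n (D : Dyn K F I lam f) (n : ℕ) (hn : 1 ≤ n) {z w : ℝ} (h : z < w) :
    F^[n] z - z < F^[n] w - w := by
  have h1 := D.conN n (F^[n] w) (F^[n] z)
  rw [D.IFn, D.IFn, abs_of_pos (by linarith),
    abs_of_pos (by linarith [D.hmono.iterate n h])] at h1
  have h2 : lam⁻¹ ^ n < 1 := pow_lt_one₀ D.linv.1 D.linv.2 (by omega)
  have h3 : 0 < F^[n] w - F^[n] z := by linarith [D.hmono.iterate n h]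
  nlinarith

lemma periodic_pts (D : Dyn K F I lam f) (n : ℕ) (hn : 1 ≤ n) (c : ℝ) (hc : F c = c) :
    ∃ p : ℕ → ℝ, (∀ j, F^[n] (p j) = p j + j) ∧
      (∀ j ∈ Finset.range (K ^ n - 1), |p j - c| ≤ 1) ∧
      Set.InjOn (fun j => (p j : AddCircle (1:ℝ))) (Finset.range (K ^ n - 1) : Set ℕ) ∧
      FixPts f n = (fun j => (p j : AddCircle (1:ℝ))) '' (Finset.range (K ^ n - 1) : Set ℕ) := by
  have hq1 : lam⁻¹ ^ n < 1 := pow_lt_one₀ D.linv.1 D.linv.2 (by omega)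
  have hex : ∀ j : ℕ, ∃ x, F^[n] x = x + j := by
    intro j
    obtain ⟨x, hx⟩ := exists_fix (fun x => I^[n] (x + j)) (lam⁻¹ ^ n) (pow_nonneg D.linv.1 n) hq1
      (fun x y => by
        refine (D.conN n _ _).trans (le_of_eq ?_)
        congr 2; ring)
    refine ⟨x, ?_⟩
    conv_lhs => rw [← hx]
    rw [D.FIn]
  choose p hp using hex
  have hcn : F^[n] c = c := Function.iterate_fixed hc n
  have h2K : 2 ≤ K ^ n := by
    calc 2 ≤ K := D.hK
      _ = K ^ 1 := (pow_one K).symm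
      _ ≤ K ^ n := Nat.pow_le_pow_right (by have := D.hK; omega) hn
  have hKn : ((K ^ n - 1 : ℕ) : ℝ) = (K:ℝ) ^ n - 1 := by
    rw [Nat.cast_sub (by omega)]; push_cast; ring
  have hlt : ∀ {z w : ℝ} {j k : ℝ}, F^[n] z = z + j → F^[n] w = w + k → j < k → z < w := by
    intro z w j k hz hw hjk
    by_contra hcon
    push Not at hcon
    rcases hcon.lt_or_eq with h | h
    · have := D.exp_n n hn h
      linarith
    · rw [h, hz] at hw; linarith
  have heq : ∀ {z w j : ℝ}, F^[n] z = z + j → F^[n] w = w + j → z = w := by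
    intro z w j hz hw
    rcases lt_trichotomy z w with h | h | h
    · have := D.exp_n n hn h; linarith
    · exact h
    · have := D.exp_n n hn h; linarith
  have hge : ∀ j, c ≤ p j := by
    intro j
    rcases Nat.eq_zero_or_pos j with h | h
    · have := hp j
      exact (heq (j := 0) (by simpa using hcn) (by rw [this, h]; simp)).le
    · exact (hlt (j := 0) (by simpa using hcn) (hp j) (by exact_mod_cast h)).le
  have hltc : ∀ j ∈ Finset.range (K ^ n - 1), p j < c + 1 := by
    intro j hj
    have h1 : F^[n] (c + 1) = (c + 1) + ((K ^ n - 1 : ℕ) : ℝ) := by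
      have := D.Fn_int n c 1
      simp only [Int.cast_one, mul_one] at this
      rw [this, hcn, hKn]; ring
    exact hlt (hp j) h1 (by exact_mod_cast Finset.mem_range.1 hj)
  refine ⟨p, hp, ?_, ?_, ?_⟩
  · intro j hj
    rw [abs_le]; constructor <;> linarith [hge j, hltc j hj]
  · intro i hi j hj hij
    obtain ⟨m, hm⟩ := (coe_eq_iff _ _).1 hij
    have hi1 := hltc i hi
    have hj1 := hltc j hj
    have hi2 := hge i
    have hj2 := hge j
    have hm1 : (m:ℝ) < 1 := by linarith
    have hm2 : (-1:ℝ) < m := by linarith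
    have hm1' : m < 1 := by exact_mod_cast hm1
    have hm2' : -1 < m := by exact_mod_cast hm2
    have hm0 : m = 0 := by omega
    rw [hm0] at hm
    have h1 := hp i
    rw [hm] at h1
    simp only [Int.cast_zero, add_zero] at h1
    rw [hp j] at h1
    have : (j:ℝ) = i := by linarith
    exact_mod_cast this.symm
  · ext q
    obtain ⟨z, -, -, rfl⟩ := coe_surj q
    simp only [FixPts, Set.mem_ofPred_eq, D.fn, coe_eq_iff, Set.mem_image]
    constructor
    · rintro ⟨m, hm⟩
      have hN0 : (0:ℤ) < ((K ^ n - 1 : ℕ) : ℤ) := by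
        have : 0 < K ^ n - 1 := by omega
        exact_mod_cast this
      set N : ℤ := ((K ^ n - 1 : ℕ) : ℤ) with hN
      have h0 := Int.emod_nonneg m hN0.ne'
      have h1 := Int.emod_lt_of_pos m hN0
      refine ⟨(m % N).toNat, ?_, -(m / N), ?_⟩
      · simp only [Finset.coe_range, Set.mem_Iio]
        omega
      · have h3 : (((m % N).toNat : ℕ) : ℝ) = ((m % N : ℤ) : ℝ) := by
          exact_mod_cast Int.toNat_of_nonneg h0
        have h2 : (m : ℝ) = ((m % N : ℤ) : ℝ) + N * ((m / N : ℤ) : ℝ) := by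
          exact_mod_cast (Int.emod_add_mul_ediv m N).symm
        have hNr : (N : ℝ) = (K:ℝ) ^ n - 1 := by rw [hN, ← hKn]; simp
        refine heq (hp _) ?_
        rw [D.Fn_int, hm, h3, h2, hNr]
        push_cast; ring
    · rintro ⟨j, -, m, hm⟩
      refine ⟨j - (K ^ n - 1) * m, ?_⟩
      have : z = p j + ((-m : ℤ) : ℝ) := by rw [hm]; push_cast; ring
      rw [this, D.Fn_int, hp]
      push_cast; ring

lemma FkIn (D : Dyn K F I lam f) {k n : ℕ} (hk : k ≤ n) (x : ℝ) : F^[k] (I^[n] x) = I^[n - k] x := by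
  conv_lhs => rw [show n = k + (n - k) by omega, Function.iterate_add_apply, D.FIn]

lemma distortion (D : Dyn K F I lam f) {L : ℝ} {h : AddCircle (1:ℝ) → ℝ} (hh : LipC L h) (n : ℕ)
    (x y : ℝ) (hxy : |x - y| ≤ 1) :
    |bS F (fun z => h (z : AddCircle (1:ℝ))) n (I^[n] x) -
      bS F (fun z => h (z : AddCircle (1:ℝ))) n (I^[n] y)| ≤ L * (1 - lam⁻¹)⁻¹ := by
  have hl := D.linv
  unfold bS
  rw [← Finset.sum_sub_distrib]
  refine (Finset.abs_sum_le_sum_abs _ _).trans ?_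
  calc _ ≤ ∑ k ∈ Finset.range n, L * lam⁻¹ ^ (n - 1 - k) := by
        apply Finset.sum_le_sum
        intro k hk
        have hk : k < n := Finset.mem_range.1 hk
        refine (hh _ _).trans ?_
        apply mul_le_mul_of_nonneg_left _ hh.nonneg
        rw [D.FkIn hk.le, D.FkIn hk.le]
        refine (D.conN _ _ _).trans ?_
        calc lam⁻¹ ^ (n - k) * |x - y| ≤ lam⁻¹ ^ (n - k) * 1 :=
              mul_le_mul_of_nonneg_left hxy (pow_nonneg hl.1 _)
          _ ≤ lam⁻¹ ^ (n - 1 - k) := by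
              rw [mul_one]
              exact pow_le_pow_of_le_one hl.1 hl.2.le (by omega)
    _ = L * ∑ k ∈ Finset.range n, lam⁻¹ ^ k := by
        rw [← Finset.mul_sum, Finset.sum_range_reflect (fun k => lam⁻¹ ^ k) n]
    _ ≤ L * (1 - lam⁻¹)⁻¹ := by
        apply mul_le_mul_of_nonneg_left _ hh.nonneg
        rw [← tsum_geometric_of_lt_one hl.1 hl.2]
        exact (summable_geometric_of_lt_one hl.1 hl.2).sum_le_tsum _ (fun k _ => pow_nonneg hl.1 k)

end Dyn

lemma emp_compare (N : ℕ) (hN : 0 < N) (X Y : ℕ → ℝ) (B : ℝ)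
    (hXY : ∀ j ∈ Finset.range N, |X j - Y j| ≤ B) (u : ℝ) :
    emp N X u ≤ emp (N + 1) Y (u + B) + 1 / N ∧ emp (N + 1) Y (u - B) - 1 / N ≤ emp N X u := by
  have hNr : (0:ℝ) < N := by exact_mod_cast hN
  have hsb : ∀ w, 0 ≤ ∑ j ∈ Finset.range (N + 1), (if Y j ≤ w then (1:ℝ) else 0) ∧
      ∑ j ∈ Finset.range (N + 1), (if Y j ≤ w then (1:ℝ) else 0) ≤ N + 1 := by
    intro w
    refine ⟨by positivity, ?_⟩
    calc _ ≤ ∑ j ∈ Finset.range (N + 1), (1:ℝ) := by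
          gcongr with j hj
          split_ifs <;> norm_num
      _ = _ := by simp
  unfold emp
  constructor
  · obtain ⟨h1, h2⟩ := hsb (u + B)
    have h3 : ∑ j ∈ Finset.range N, (if X j ≤ u then (1:ℝ) else 0) ≤
        ∑ j ∈ Finset.range (N + 1), (if Y j ≤ u + B then (1:ℝ) else 0) := by
      rw [Finset.sum_range_succ]
      have : ∑ j ∈ Finset.range N, (if X j ≤ u then (1:ℝ) else 0) ≤
          ∑ j ∈ Finset.range N, (if Y j ≤ u + B then (1:ℝ) else 0) := by
        apply Finset.sum_le_sum
        intro j hj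
        have := abs_le.1 (hXY j hj)
        split_ifs <;> first | (norm_num; done) | (exfalso; linarith [this.1])
      have h4 : (0:ℝ) ≤ (if Y N ≤ u + B then (1:ℝ) else 0) := by positivity
      linarith
    set A := ∑ j ∈ Finset.range (N + 1), (if Y j ≤ u + B then (1:ℝ) else 0)
    push_cast
    calc _ ≤ (N:ℝ)⁻¹ * A := by gcongr
      _ ≤ _ := by
        rw [← sub_nonneg]
        have : ((N:ℝ) + 1)⁻¹ * A + 1 / N - (N:ℝ)⁻¹ * A = (N + 1 - A) / (N * (N + 1)) := by
          field_simp; ring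
        rw [this]
        apply div_nonneg (by linarith) (by positivity)
  · obtain ⟨h1, h2⟩ := hsb (u - B)
    have h3 : ∑ j ∈ Finset.range (N + 1), (if Y j ≤ u - B then (1:ℝ) else 0) - 1 ≤
        ∑ j ∈ Finset.range N, (if X j ≤ u then (1:ℝ) else 0) := by
      rw [Finset.sum_range_succ]
      have : ∑ j ∈ Finset.range N, (if Y j ≤ u - B then (1:ℝ) else 0) ≤
          ∑ j ∈ Finset.range N, (if X j ≤ u then (1:ℝ) else 0) := by
        apply Finset.sum_le_sum
        intro j hj
        have := abs_le.1 (hXY j hj)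
        split_ifs <;> first | (norm_num; done) | (exfalso; linarith [this.2])
      have h4 : (if Y N ≤ u - B then (1:ℝ) else 0) ≤ 1 := by split_ifs <;> norm_num
      linarith
    set A := ∑ j ∈ Finset.range (N + 1), (if Y j ≤ u - B then (1:ℝ) else 0)
    push_cast
    calc _ ≤ (N:ℝ)⁻¹ * (A - 1) := by
          rw [← sub_nonneg]
          have : (N:ℝ)⁻¹ * (A - 1) - (((N:ℝ) + 1)⁻¹ * A - 1 / N) = A / (N * (N + 1)) := by
            field_simp; ring
          rw [this]
          positivity
      _ ≤ _ := by gcongr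

lemma card_emp (N : ℕ) (g : ℕ → AddCircle (1:ℝ)) (S : Set (AddCircle (1:ℝ)))
    (hinj : Set.InjOn g (Finset.range N : Set ℕ)) (hS : S = g '' (Finset.range N : Set ℕ))
    (T : AddCircle (1:ℝ) → Prop) (X : ℕ → ℝ) (u : ℝ) (hT : ∀ j, T (g j) ↔ X j ≤ u) :
    (Nat.card {p : AddCircle (1:ℝ) // p ∈ S ∧ T p} : ℝ) / (Nat.card S : ℝ) = emp N X u := by
  classical
  have h1 : Nat.card S = N := by
    rw [hS, Nat.card_image_of_injOn hinj]; simp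
  have h2 : {p : AddCircle (1:ℝ) | p ∈ S ∧ T p} = g '' (((Finset.range N).filter fun j => X j ≤ u : Finset ℕ) : Set ℕ) := by
    ext p
    simp only [hS, Set.mem_ofPred_eq, Set.mem_image, Finset.coe_filter, Finset.coe_range, Set.mem_Iio,
      Finset.mem_range]
    constructor
    · rintro ⟨⟨j, hj, rfl⟩, ht⟩
      exact ⟨j, ⟨hj, (hT j).1 ht⟩, rfl⟩
    · rintro ⟨j, ⟨hj, hx⟩, rfl⟩
      exact ⟨⟨j, hj, rfl⟩, (hT j).2 hx⟩
  have h3 : Nat.card {p : AddCircle (1:ℝ) // p ∈ S ∧ T p} = ((Finset.range N).filter fun j => X j ≤ u).card := by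
    change Nat.card ({p : AddCircle (1:ℝ) | p ∈ S ∧ T p} : Set _) = _
    rw [h2, Nat.card_image_of_injOn]
    · rw [Nat.card_coe_set_eq, Set.ncard_coe_finset]
    · refine hinj.mono ?_
      intro j hj
      exact (Finset.filter_subset _ _) hj
  rw [h1, h3]
  unfold emp
  rw [Finset.sum_boole, div_eq_inv_mul]

lemma mk_dyn (K : ℕ) (hK : 2 ≤ K)
    (F : ℝ → ℝ) (hF : ContDiff ℝ 2 F)
    (hdeg : ∀ x : ℝ, F (x + 1) = F x + K)
    (lam : ℝ) (hlam : 1 < lam)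
    (hexp : ∀ x : ℝ, lam ≤ deriv F x)
    (f : AddCircle (1:ℝ) → AddCircle (1:ℝ))
    (hfF : ∀ x : ℝ, f (x : AddCircle (1:ℝ)) = ((F x : ℝ) : AddCircle (1:ℝ))) :
    ∃ I, Dyn K F I lam f := by
  have hdiff : Differentiable ℝ F := hF.differentiable (by norm_num)
  have hexp2 : ∀ x y, x ≤ y → lam * (y - x) ≤ F y - F x := fun x y hxy =>
    mul_sub_le_image_sub_of_le_deriv hdiff hexp hxy
  have hmono : StrictMono F := strictMono_of_deriv_pos fun x => by linarith [hexp x]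
  have hsurj : Function.Surjective F := by
    apply hdiff.continuous.surjective
    · apply tendsto_atTop_mono' atTop (f₁ := fun x => lam * x + F 0)
      · filter_upwards [eventually_ge_atTop 0] with x hx
        have := hexp2 0 x hx
        simp only [sub_zero] at this
        linarith
      · exact tendsto_atTop_add_const_right _ _ (tendsto_id.const_mul_atTop (by linarith))
    · apply tendsto_atBot_mono' atBot (f₁ := fun x => lam * x + F 0)
      · filter_upwards [eventually_le_atBot 0] with x hx
        have := hexp2 x 0 hx
        simp only [zero_sub] at this
        linarith
      · exact tendsto_atBot_add_const_right _ _ (tendsto_id.const_mul_atBot (by linarith))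
  let e := Equiv.ofBijective F ⟨hmono.injective, hsurj⟩
  have hFI : ∀ x, F (e.symm x) = x := fun x => e.apply_symm_apply x
  have hIF : ∀ x, e.symm (F x) = x := fun x => e.symm_apply_apply x
  have habs : ∀ x y, lam * |x - y| ≤ |F x - F y| := by
    intro x y
    rcases le_total x y with h | h
    · rw [abs_sub_comm, abs_sub_comm (F x), abs_of_nonneg (by linarith)]
      exact (hexp2 x y h).trans (le_abs_self _)
    · rw [abs_of_nonneg (by linarith)]
      exact (hexp2 y x h).trans (le_abs_self _)
  refine ⟨e.symm, hK, hlam, hFI, hIF, ?_, hmono, hdiff.continuous, hdeg, hfF⟩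
  intro x y
  have := habs (e.symm x) (e.symm y)
  rw [hFI, hFI] at this
  rw [inv_mul_eq_div, le_div_iff₀ (by linarith)]
  linarith

lemma log_lip (K : ℕ)
    (F : ℝ → ℝ) (hF : ContDiff ℝ 2 F)
    (hdeg : ∀ x : ℝ, F (x + 1) = F x + K)
    (lam : ℝ) (hlam : 1 < lam)
    (hexp : ∀ x : ℝ, lam ≤ deriv F x)
    (f' : AddCircle (1:ℝ) → ℝ)
    (hf'F : ∀ x : ℝ, f' (x : AddCircle (1:ℝ)) = deriv F x) :
    ∃ L, LipC L (fun p => Real.log (f' p)) := by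
  have h1 : ContDiff ℝ 1 (deriv F) := by
    have : ContDiff ℝ (1 + 1) F := by
      have e : (1 + 1 : WithTop ℕ∞) = 2 := by norm_num
      rw [e]; exact hF
    exact (contDiff_succ_iff_deriv.1 this).2.2
  have h2 : ContDiff ℝ 1 (fun x => Real.log (deriv F x)) :=
    h1.log fun x => by linarith [hexp x]
  have hper : ∀ x, deriv F (x + 1) = deriv F x := by
    intro x
    rw [← deriv_comp_add_const]
    have : (fun x => F (x + 1)) = fun x => F x + K := funext hdeg
    rw [this, deriv_add_const]
  have hperl : ∀ x, deriv (fun x => Real.log (deriv F x)) (x + 1) = deriv (fun x => Real.log (deriv F x)) x := by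
    intro x
    rw [← deriv_comp_add_const]
    simp only [hper]
  have hb := Function.Periodic.isBounded_of_continuous (c := (1:ℝ)) hperl one_ne_zero (h2.continuous_deriv le_rfl)
  obtain ⟨C, hC⟩ := hb.exists_norm_le
  refine ⟨C, ?_⟩
  intro x y
  simp only [hf'F]
  have := Convex.norm_image_sub_le_of_norm_deriv_le (s := Set.univ) (f := fun x => Real.log (deriv F x)) (C := C)
    (fun z _ => (h2.differentiable (by norm_num)).differentiableAt)
    (fun z _ => hC _ ⟨z, rfl⟩) convex_univ (Set.mem_univ y) (Set.mem_univ x)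
  simpa [Real.norm_eq_abs] using this

lemma preimage_clt {K : ℕ} {F I : ℝ → ℝ} {lam : ℝ} {f : AddCircle (1:ℝ) → AddCircle (1:ℝ)}
    {μ : Measure (AddCircle (1:ℝ))} [IsProbabilityMeasure μ] (D : Dyn K F I lam f)
    (hμ : ∀ φ : AddCircle (1:ℝ) → ℝ, Continuous φ → ∫ x, transfer f φ x ∂μ = (K : ℝ) * ∫ x, φ x ∂μ)
    {L : ℝ} {h : AddCircle (1:ℝ) → ℝ} (hh : LipC L h) (h0 : ∫ x, h x ∂μ = 0) (sigma : ℝ) (hs : 0 < sigma)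
    (hv : sigma ^ 2 = ∫ x, h x ^ 2 ∂μ + 2 * ∑' j : ℕ, ∫ x, h x * h (f^[j + 1] x) ∂μ) :
    ∃ C : ℝ, 0 ≤ C ∧ ∀ n : ℕ, 1 ≤ n → ∀ c u : ℝ,
      |emp (K ^ n) (fun j => bS F (fun z => h (z : AddCircle (1:ℝ))) n (I^[n] (c + j))) u -
        gPhi (u / (sigma * √(n:ℝ)))| ≤ C / √√(n:ℝ) := by
  obtain ⟨a, b, L1, L2, ha, hb, hd0, hvar⟩ := D.correctors hμ hh h0 (sigma ^ 2) hv
  obtain ⟨Bh, hBh0, hBh⟩ := hh.bdd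
  obtain ⟨Ba, hBa0, hBa⟩ := ha.bdd
  obtain ⟨Bb, hBb0, hBb⟩ := hb.bdd
  have hKpos : 0 < K := by have := D.hK; omega
  obtain ⟨C, hC0, hC⟩ := smooth_bound K hKpos F I (fun z => h (z : AddCircle (1:ℝ)))
    (fun z => a (z : AddCircle (1:ℝ))) (fun z => b (z : AddCircle (1:ℝ))) (sigma ^ 2) (Bh + 2 * Ba + Bb)
    (by positivity) (by positivity) D.hFI D.I_nat
    (fun x j => by
      have : ((x + j : ℝ) : AddCircle (1:ℝ)) = x := (coe_eq_iff _ _).2 ⟨j, by simp⟩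
      simp only [this])
    (fun x i => by
      have h1 := abs_le.1 (hBh (I (x + i) : ℝ))
      have h2 := abs_le.1 (hBa (I (x + i) : ℝ))
      have h3 := abs_le.1 (hBa (x : ℝ))
      rw [abs_le]; constructor <;> linarith [h1.1, h1.2, h2.1, h2.2, h3.1, h3.2])
    (fun x => (hBa _).trans (by linarith))
    (fun x => (hBb _).trans (by linarith)) hd0 hvar
  refine ⟨2 * (C + 9 / sigma ^ 2 + 3 / sigma), by positivity, ?_⟩
  intro n hn c u
  have hnr : (1:ℝ) ≤ n := by exact_mod_cast hn
  set r := √(n:ℝ) with hr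
  have hr1 : 1 ≤ r := by rw [hr]; exact Real.one_le_sqrt.2 hnr
  have hrr : r * r = n := Real.mul_self_sqrt (by linarith)
  set δ := √r with hδ
  have hδ1 : 1 ≤ δ := by rw [hδ]; exact Real.one_le_sqrt.2 hr1
  have hδδ : δ * δ = r := Real.mul_self_sqrt (by linarith)
  have hδ0 : 0 < δ := by linarith
  have hr0 : 0 < r := by linarith
  have hsn : √((n:ℝ) * sigma ^ 2) = sigma * r := by
    rw [Real.sqrt_mul (by linarith), Real.sqrt_sq hs.le, mul_comm]
  have key := emp_unsmooth (K ^ n) (pow_pos hKpos n)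
    (fun j => bS F (fun z => h (z : AddCircle (1:ℝ))) n (I^[n] (c + j))) δ (sigma * r)
    ((C + 9 / sigma ^ 2) / δ) hδ0 (by positivity) (fun w => by
      have h1 := hC r hr1 n c w
      have h2 := gG_lip_t w (n * sigma ^ 2) r (by positivity) hr0.le
      have h3 : gG w (n * sigma ^ 2) = gPhi (w / (sigma * r)) := by
        unfold gG; rw [hsn]
      rw [h3, add_comm] at h2
      push_cast
      have h4 : 9 * r / (n * sigma ^ 2) ≤ 9 / sigma ^ 2 / δ := by
        rw [← hrr, ← hδδ, div_div]
        rw [div_le_div_iff₀ (by positivity) (by positivity)]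
        have : 9 * (δ * δ) * (sigma ^ 2 * δ) * 1 ≤ 9 * (δ * δ) * (sigma ^ 2 * δ) * δ := by gcongr
        nlinarith [this]
      have h5 : (C + 9 / sigma ^ 2) / δ = C / δ + 9 / sigma ^ 2 / δ := by ring
      rw [h5]
      have := abs_sub_le (((K : ℝ) ^ n)⁻¹ * ∑ j ∈ Finset.range (K ^ n),
        gG (w - bS F (fun z => h (z : AddCircle (1:ℝ))) n (I^[n] (c + j))) r) (gG w (r + n * sigma ^ 2))
        (gPhi (w / (sigma * r)))
      exact this.trans (add_le_add h1 (h2.trans h4))) u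
  refine key.trans (le_of_eq ?_)
  rw [← hδδ]
  field_simp

lemma main_bound {K : ℕ} {F I : ℝ → ℝ} {lam : ℝ} {f : AddCircle (1:ℝ) → AddCircle (1:ℝ)}
    {μ : Measure (AddCircle (1:ℝ))} [IsProbabilityMeasure μ] (D : Dyn K F I lam f)
    (hμ : ∀ φ : AddCircle (1:ℝ) → ℝ, Continuous φ → ∫ x, transfer f φ x ∂μ = (K : ℝ) * ∫ x, φ x ∂μ)
    {L : ℝ} {h : AddCircle (1:ℝ) → ℝ} (hh : LipC L h) (h0 : ∫ x, h x ∂μ = 0) (sigma : ℝ) (hs : 0 < sigma)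
    (hv : sigma ^ 2 = ∫ x, h x ^ 2 ∂μ + 2 * ∑' j : ℕ, ∫ x, h x * h (f^[j + 1] x) ∂μ) :
    ∃ C : ℝ, 0 < C ∧ ∀ n : ℕ, 1 ≤ n → ∀ x : ℝ, ∀ T : AddCircle (1:ℝ) → Prop,
      (∀ p, T p ↔ ∑ k ∈ Finset.range n, h (f^[k] p) ≤ sigma * √(n:ℝ) * x) →
      |(Nat.card {p : AddCircle (1:ℝ) // p ∈ FixPts f n ∧ T p} : ℝ) / (Nat.card (FixPts f n) : ℝ) -
        gPhi x| ≤ C / √√(n:ℝ) := by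
  obtain ⟨C, hC0, hC⟩ := preimage_clt D hμ hh h0 sigma hs hv
  obtain ⟨c, hc⟩ := D.fixed
  set B := L * (1 - lam⁻¹)⁻¹ with hB
  have hB0 : 0 ≤ B := mul_nonneg hh.nonneg (inv_nonneg.2 (by linarith [D.linv.2]))
  refine ⟨C + B / sigma + 1, by positivity, ?_⟩
  intro n hn x T hT
  have hnr : (1:ℝ) ≤ n := by exact_mod_cast hn
  obtain ⟨p, hp1, hp2, hp3, hp4⟩ := D.periodic_pts n hn c hc
  set r := √(n:ℝ) with hr
  have hr1 : 1 ≤ r := by rw [hr]; exact Real.one_le_sqrt.2 hnr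
  have hrr : r * r = n := Real.mul_self_sqrt (by linarith)
  set δ := √r with hδ
  have hδ1 : 1 ≤ δ := by rw [hδ]; exact Real.one_le_sqrt.2 hr1
  have hδδ : δ * δ = r := Real.mul_self_sqrt (by linarith)
  have hδ0 : 0 < δ := by linarith
  have hr0 : 0 < r := by linarith
  have hδr : δ ≤ r := by nlinarith
  have hrn : r ≤ n := by nlinarith
  have hnK : n < K ^ n := Nat.lt_pow_self (by have := D.hK; omega)
  obtain ⟨N, hN⟩ : ∃ N, K ^ n = N + 1 := ⟨K ^ n - 1, by omega⟩
  have hNn : n ≤ N := by omega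
  have hN1 : K ^ n - 1 = N := by omega
  rw [hN1] at hp2 hp3 hp4
  set X : ℕ → ℝ := fun j => bS F (fun z => h (z : AddCircle (1:ℝ))) n (p j) with hX
  set Y : ℕ → ℝ := fun j => bS F (fun z => h (z : AddCircle (1:ℝ))) n (I^[n] (c + j)) with hY
  have hce := card_emp N (fun j => (p j : AddCircle (1:ℝ))) (FixPts f n) hp3 hp4 T X (sigma * r * x)
    (fun j => by
      rw [hT]
      simp only [hX, bS, D.fn])
  rw [hce]
  have hXY : ∀ j ∈ Finset.range N, |X j - Y j| ≤ B := by
    intro j hj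
    have h1 : p j = I^[n] (p j + j) := by rw [← hp1 j, D.IFn]
    have h2 := D.distortion hh n (p j + j) (c + j) (by
      rw [add_sub_add_right_eq_sub]; exact hp2 j hj)
    rw [← h1] at h2
    exact h2
  obtain ⟨e1, e2⟩ := emp_compare N (by omega) X Y B hXY (sigma * r * x)
  have hNr : (1:ℝ) / N ≤ 1 / δ := by
    apply one_div_le_one_div_of_le hδ0
    have : (n:ℝ) ≤ N := by exact_mod_cast hNn
    linarith
  have c1 := hC n hn c (sigma * r * x + B)
  have c2 := hC n hn c (sigma * r * x - B)
  rw [hN] at c1 c2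
  have hBs : B / (sigma * r) ≤ B / sigma / δ := by
    rw [div_div]; gcongr
  have hsr : 0 < sigma * r := by positivity
  have g1 : |gPhi ((sigma * r * x + B) / (sigma * r)) - gPhi x| ≤ B / sigma / δ := by
    refine (gPhi_lip _ _).trans ?_
    have : (sigma * r * x + B) / (sigma * r) - x = B / (sigma * r) := by field_simp; ring
    rw [this, abs_of_nonneg (by positivity)]; exact hBs
  have g2 : |gPhi ((sigma * r * x - B) / (sigma * r)) - gPhi x| ≤ B / sigma / δ := by
    refine (gPhi_lip _ _).trans ?_
    have : (sigma * r * x - B) / (sigma * r) - x = -(B / (sigma * r)) := by field_simp; ring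
    rw [this, abs_neg, abs_of_nonneg (by positivity)]; exact hBs
  have hsum : (C + B / sigma + 1) / δ = C / δ + B / sigma / δ + 1 / δ := by ring
  rw [hsum]
  rw [abs_le] at c1 c2 g1 g2 ⊢
  constructor <;> linarith [c1.1, c1.2, c2.1, c2.2, g1.1, g1.2, g2.1, g2.2]

/-- Berry–Esseen type bound for the distribution function of `√n(χ_n - χ̄)/σ`. -/
theorem stmt16
    (K : ℕ) (hK : 2 ≤ K)
    (F : ℝ → ℝ) (hF : ContDiff ℝ 2 F)
    (hdeg : ∀ x : ℝ, F (x + 1) = F x + K)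
    (lam : ℝ) (hlam : 1 < lam)
    (hexp : ∀ x : ℝ, lam ≤ deriv F x)
    (f : AddCircle (1:ℝ) → AddCircle (1:ℝ))
    (hfF : ∀ x : ℝ, f (x : AddCircle (1:ℝ)) = ((F x : ℝ) : AddCircle (1:ℝ)))
    (f' : AddCircle (1:ℝ) → ℝ)
    (hf'F : ∀ x : ℝ, f' (x : AddCircle (1:ℝ)) = deriv F x)
    (μ : Measure (AddCircle (1:ℝ))) [IsProbabilityMeasure μ]
    (hinv : ∀ φ : AddCircle (1:ℝ) → ℝ, Continuous φ → ∫ x, φ (f x) ∂μ = ∫ x, φ x ∂μ)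
    (hμ : ∀ φ : AddCircle (1:ℝ) → ℝ, Continuous φ → ∫ x, transfer f φ x ∂μ = (K : ℝ) * ∫ x, φ x ∂μ)
    (hnc : ¬ SmoothConj K f)
    (sigma : ℝ) (hsigma : 0 < sigma) (hsigma2 : sigma ^ 2 = asymVar f f' μ) :
    ∃ C : ℝ, 0 < C ∧ ∀ n : ℕ, 1 ≤ n → ∀ x : ℝ,
      |(Nat.card {p : AddCircle (1:ℝ) // p ∈ FixPts f n ∧
            Real.sqrt n * (chi f f' n p - ∫ y, Real.log (f' y) ∂μ) / sigma ≤ x} : ℝ) /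
          (Nat.card (FixPts f n) : ℝ) -
        (Real.sqrt (2 * Real.pi))⁻¹ * ∫ y in Set.Iic x, Real.exp (-y ^ 2 / 2)| ≤
      C / (n : ℝ) ^ ((1 : ℝ) / 4) := by
  obtain ⟨I, D⟩ := mk_dyn K hK F hF hdeg lam hlam hexp f hfF
  obtain ⟨L, hL⟩ := log_lip K F hF hdeg lam hlam hexp f' hf'F
  set m := ∫ y, Real.log (f' y) ∂μ with hm
  have hh : LipC (L + 0) (fun p => Real.log (f' p) - m) := hL.sub (LipC.const m)
  have h0 : ∫ p, (Real.log (f' p) - m) ∂μ = 0 := by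
    rw [integral_sub (hL.integ μ) (integrable_const m), integral_const]
    simp [hm]
  obtain ⟨C, hC0, hC⟩ := main_bound D hμ hh h0 sigma hsigma hsigma2
  refine ⟨C, hC0, ?_⟩
  intro n hn x
  have hn0 : (0:ℝ) < n := by exact_mod_cast hn
  have hr0 : 0 < √(n:ℝ) := Real.sqrt_pos.2 hn0
  have hpow : (n : ℝ) ^ ((1 : ℝ) / 4) = √√(n:ℝ) := by
    rw [Real.sqrt_eq_rpow, Real.sqrt_eq_rpow, ← Real.rpow_mul hn0.le]
    norm_num
  rw [hpow]
  refine hC n hn x (fun p => Real.sqrt n * (chi f f' n p - m) / sigma ≤ x) ?_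
  intro p
  have hrr : √(n:ℝ) * √(n:ℝ) = n := Real.mul_self_sqrt hn0.le
  have e1 : ∑ k ∈ Finset.range n, (Real.log (f' (f^[k] p)) - m) =
      √(n:ℝ) * (√(n:ℝ) * (chi f f' n p - m)) := by
    rw [Finset.sum_sub_distrib, Finset.sum_const, Finset.card_range, nsmul_eq_mul, ← mul_assoc, hrr]
    unfold chi
    field_simp
  rw [e1, div_le_iff₀ hsigma]
  have e2 : sigma * √(n:ℝ) * x = √(n:ℝ) * (x * sigma) := by ring
  rw [e2]
  exact (mul_le_mul_iff_right₀ hr0).symm
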